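/- Let N ≥ 5 be an integer, p > 1, and let s₀ be the unique root in (2t₀, ∞) of L(s) = s⁴ − (32p/(p+1))s² + (32p(p+3)/(p+1)²)s − 64p/(p+1)², where t₀ = √(2p/(p+1)) + √(2p/(p+1) − √(2p/(p+1))). Let u be a classical stable solution of Δ²u = u^p, u > 0 in ℝ^N and v = −Δu. Then for every real β with 2 ≤ β < (N/(N−2))·s₀, there exist an integer ℓ ≥ 0 and a constant C > 0 (independent of R) such that (∫_{B_R} v^β dx)^{1/β} ≤ C · R^{(N/2)(2/β − 1)} · (∫_{B_{2^{3ℓ} R}} v² dx)^{1/2} for all R > 0. -/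

import Mathlib

open MeasureTheory Real

/-- The Laplacian of a function on `ℝ^N` (sum of pure second derivatives). -/
noncomputable def lap {N : ℕ} (u : EuclideanSpace ℝ (Fin N) → ℝ)
    (x : EuclideanSpace ℝ (Fin N)) : ℝ :=
  ∑ i : Fin N, fderiv ℝ (fun y => fderiv ℝ u y (EuclideanSpace.single i 1)) x
    (EuclideanSpace.single i 1)
/-- The quartic polynomial `L`. -/
noncomputable def Lpoly (p s : ℝ) : ℝ :=
  s ^ 4 - 32 * p / (p + 1) * s ^ 2 + 32 * p * (p + 3) / (p + 1) ^ 2 * s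
    - 64 * p / (p + 1) ^ 2

/-- `t₀ = √(2p/(p+1)) + √(2p/(p+1) − √(2p/(p+1)))`. -/
noncomputable def t0 (p : ℝ) : ℝ :=
  Real.sqrt (2 * p / (p + 1)) +
    Real.sqrt (2 * p / (p + 1) - Real.sqrt (2 * p / (p + 1)))

/-- The partial derivative of `f` in the `i`-th coordinate direction. -/
noncomputable def pd {N : ℕ} (i : Fin N) (f : EuclideanSpace ℝ (Fin N) → ℝ)
    (x : EuclideanSpace ℝ (Fin N)) : ℝ :=
  fderiv ℝ f x (EuclideanSpace.single i 1)

/-- The scalar product `∇f · ∇g`. -/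
noncomputable def gdot {N : ℕ} (f g : EuclideanSpace ℝ (Fin N) → ℝ)
    (x : EuclideanSpace ℝ (Fin N)) : ℝ :=
  ∑ i : Fin N, pd i f x * pd i g x

section Calculus

variable {N : ℕ} {f g : EuclideanSpace ℝ (Fin N) → ℝ}

theorem lap_eq_sum_pd (f : EuclideanSpace ℝ (Fin N) → ℝ) (x : EuclideanSpace ℝ (Fin N)) :
    lap f x = ∑ i, pd i (pd i f) x := rfl

theorem contDiff_pd {n m : WithTop ℕ∞} (hf : ContDiff ℝ n f) (hmn : m + 1 ≤ n) (i : Fin N) :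
    ContDiff ℝ m (pd i f) :=
  (hf.fderiv_right hmn).clm_apply contDiff_const

theorem contDiff_lap {n m : WithTop ℕ∞} (hf : ContDiff ℝ n f) (hmn : m + 2 ≤ n) :
    ContDiff ℝ m (lap f) := by
  have h : m + 1 + 1 ≤ n := by rwa [add_assoc, one_add_one_eq_two]
  exact ContDiff.sum fun i _ => contDiff_pd (contDiff_pd hf h i) le_rfl i

theorem contDiff_gdot {n m : WithTop ℕ∞} (hf : ContDiff ℝ n f) (hg : ContDiff ℝ n g)
    (hmn : m + 1 ≤ n) : ContDiff ℝ m (gdot f g) :=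
  ContDiff.sum fun i _ => (contDiff_pd hf hmn i).mul (contDiff_pd hg hmn i)

theorem continuous_pd (hf : ContDiff ℝ 1 f) (i : Fin N) : Continuous (pd i f) :=
  (contDiff_pd hf (m := 0) (by simp) i).continuous

theorem continuous_lap (hf : ContDiff ℝ 2 f) : Continuous (lap f) :=
  (contDiff_lap hf (m := 0) (by simp)).continuous

theorem continuous_gdot (hf : ContDiff ℝ 1 f) (hg : ContDiff ℝ 1 g) :
    Continuous (gdot f g) :=
  (contDiff_gdot hf hg (m := 0) (by simp)).continuous

theorem gdot_comm (f g : EuclideanSpace ℝ (Fin N) → ℝ) (x : EuclideanSpace ℝ (Fin N)) :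
    gdot f g x = gdot g f x := by
  simp only [gdot, mul_comm]

theorem gdot_self_nonneg (f : EuclideanSpace ℝ (Fin N) → ℝ) (x : EuclideanSpace ℝ (Fin N)) :
    0 ≤ gdot f f x :=
  Finset.sum_nonneg fun _ _ => mul_self_nonneg _

theorem pd_mul {i : Fin N} {x : EuclideanSpace ℝ (Fin N)} (hf : DifferentiableAt ℝ f x)
    (hg : DifferentiableAt ℝ g x) :
    pd i (fun y => f y * g y) x = f x * pd i g x + g x * pd i f x := by
  simp [pd, fderiv_fun_mul hf hg]

theorem pd_add {i : Fin N} {x : EuclideanSpace ℝ (Fin N)} (hf : DifferentiableAt ℝ f x)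
    (hg : DifferentiableAt ℝ g x) :
    pd i (fun y => f y + g y) x = pd i f x + pd i g x := by
  simp [pd, fderiv_fun_add hf hg]

theorem pd_const_mul {i : Fin N} {x : EuclideanSpace ℝ (Fin N)} (c : ℝ)
    (hf : DifferentiableAt ℝ f x) :
    pd i (fun y => c * f y) x = c * pd i f x := by
  simp [pd, fderiv_const_mul hf]

theorem pd_neg {i : Fin N} (x : EuclideanSpace ℝ (Fin N)) :
    pd i (fun y => -f y) x = -pd i f x := by
  simp [pd, fderiv_fun_neg]

theorem pd_rpow {i : Fin N} {x : EuclideanSpace ℝ (Fin N)} (a : ℝ)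
    (hf : DifferentiableAt ℝ f x) (h0 : f x ≠ 0) :
    pd i (fun y => f y ^ a) x = a * f x ^ (a - 1) * pd i f x := by
  have h := (hf.hasFDerivAt.rpow_const (p := a) (Or.inl h0)).fderiv
  simp [pd, h]

theorem pd_pow {i : Fin N} {x : EuclideanSpace ℝ (Fin N)} (n : ℕ)
    (hf : DifferentiableAt ℝ f x) :
    pd i (fun y => f y ^ n) x = n * f x ^ (n - 1) * pd i f x := by
  have h := (hf.hasFDerivAt.pow n).fderiv
  simp [pd, h]

theorem lap_neg (x : EuclideanSpace ℝ (Fin N)) : lap (fun y => -f y) x = -lap f x := by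
  have : ∀ i : Fin N, pd i (fun y => -f y) = fun y => -pd i f y := fun i => funext fun y => pd_neg y
  simp only [lap_eq_sum_pd, this, pd_neg, Finset.sum_neg_distrib]

theorem lap_add (hf : ContDiff ℝ 2 f) (hg : ContDiff ℝ 2 g) (x : EuclideanSpace ℝ (Fin N)) :
    lap (fun y => f y + g y) x = lap f x + lap g x := by
  have hf1 := hf.differentiable (by norm_num)
  have hg1 := hg.differentiable (by norm_num)
  have : ∀ i : Fin N, pd i (fun y => f y + g y) = fun y => pd i f y + pd i g y :=
    fun i => funext fun y => pd_add (hf1 y) (hg1 y)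
  simp only [lap_eq_sum_pd, this, ← Finset.sum_add_distrib]
  refine Finset.sum_congr rfl fun i _ => pd_add ?_ ?_
  · exact (contDiff_pd hf (m := 1) (by norm_num) i).differentiable (by norm_num) x
  · exact (contDiff_pd hg (m := 1) (by norm_num) i).differentiable (by norm_num) x

theorem lap_const_mul (c : ℝ) (hf : ContDiff ℝ 2 f) (x : EuclideanSpace ℝ (Fin N)) :
    lap (fun y => c * f y) x = c * lap f x := by
  have hf1 := hf.differentiable (by norm_num)
  have : ∀ i : Fin N, pd i (fun y => c * f y) = fun y => c * pd i f y :=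
    fun i => funext fun y => pd_const_mul c (hf1 y)
  simp only [lap_eq_sum_pd, this, Finset.mul_sum]
  refine Finset.sum_congr rfl fun i _ => pd_const_mul c ?_
  exact (contDiff_pd hf (m := 1) (by norm_num) i).differentiable (by norm_num) x

theorem lap_mul (hf : ContDiff ℝ 2 f) (hg : ContDiff ℝ 2 g) (x : EuclideanSpace ℝ (Fin N)) :
    lap (fun y => f y * g y) x = f x * lap g x + 2 * gdot f g x + g x * lap f x := by
  have hf1 := hf.differentiable (by norm_num)
  have hg1 := hg.differentiable (by norm_num)
  have hf2 := fun i => (contDiff_pd hf (m := 1) (by norm_num) i).differentiable (by norm_num)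
  have hg2 := fun i => (contDiff_pd hg (m := 1) (by norm_num) i).differentiable (by norm_num)
  have : ∀ i : Fin N, pd i (fun y => f y * g y) = fun y => f y * pd i g y + g y * pd i f y :=
    fun i => funext fun y => pd_mul (hf1 y) (hg1 y)
  simp only [lap_eq_sum_pd, gdot, this, Finset.mul_sum, ← Finset.sum_add_distrib]
  refine Finset.sum_congr rfl fun i _ => ?_
  rw [pd_add ((hf1 x).fun_mul (hg2 i x)) ((hg1 x).fun_mul (hf2 i x)), pd_mul (hf1 x) (hg2 i x),
    pd_mul (hg1 x) (hf2 i x)]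
  ring

theorem lap_rpow (a : ℝ) (hf : ContDiff ℝ 2 f) (h0 : ∀ y, 0 < f y)
    (x : EuclideanSpace ℝ (Fin N)) :
    lap (fun y => f y ^ a) x
      = a * f x ^ (a - 1) * lap f x + a * (a - 1) * f x ^ (a - 2) * gdot f f x := by
  have hf1 := hf.differentiable (by norm_num)
  have hf2 := fun i => (contDiff_pd hf (m := 1) (by norm_num) i).differentiable (by norm_num)
  have : ∀ i : Fin N, pd i (fun y => f y ^ a) = fun y => a * f y ^ (a - 1) * pd i f y :=
    fun i => funext fun y => pd_rpow a (hf1 y) (h0 y).ne'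
  have hd : DifferentiableAt ℝ (fun y => f y ^ (a - 1)) x :=
    (hf1 x).rpow_const (Or.inl (h0 x).ne')
  simp only [lap_eq_sum_pd, gdot, this, Finset.mul_sum, ← Finset.sum_add_distrib]
  refine Finset.sum_congr rfl fun i _ => ?_
  rw [pd_mul (hd.const_mul a) (hf2 i x), pd_const_mul a hd, pd_rpow _ (hf1 x) (h0 x).ne',
    show a - 1 - 1 = a - 2 by ring]
  ring

theorem lap_pow (n : ℕ) (hf : ContDiff ℝ 2 f) (x : EuclideanSpace ℝ (Fin N)) :
    lap (fun y => f y ^ (n + 2)) x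
      = (n + 2) * f x ^ (n + 1) * lap f x + (n + 2) * (n + 1) * f x ^ n * gdot f f x := by
  have hf1 := hf.differentiable (by norm_num)
  have hf2 := fun i => (contDiff_pd hf (m := 1) (by norm_num) i).differentiable (by norm_num)
  have : ∀ i : Fin N, pd i (fun y => f y ^ (n + 2))
      = fun y => ((n + 2) * f y ^ (n + 1)) * pd i f y := by
    intro i; funext y; rw [pd_pow _ (hf1 y)]; push_cast; rfl
  have hd : DifferentiableAt ℝ (fun y => f y ^ (n + 1)) x := (hf1 x).pow _
  simp only [lap_eq_sum_pd, gdot, this, Finset.mul_sum, ← Finset.sum_add_distrib]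
  refine Finset.sum_congr rfl fun i _ => ?_
  rw [pd_mul (hd.const_mul _) (hf2 i x), pd_const_mul _ hd, pd_pow _ (hf1 x)]
  push_cast
  ring

theorem tsupport_pd_subset (f : EuclideanSpace ℝ (Fin N) → ℝ) (i : Fin N) :
    tsupport (pd i f) ⊆ tsupport f := by
  refine closure_minimal (fun y hy => ?_) (isClosed_tsupport f)
  have : fderiv ℝ f y ≠ 0 := fun h => hy (by simp [pd, h])
  exact support_fderiv_subset ℝ this

theorem hasCompactSupport_pd (hf : HasCompactSupport f) (i : Fin N) :
    HasCompactSupport (pd i f) :=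
  hf.of_isClosed_subset (isClosed_tsupport _) (tsupport_pd_subset f i)

theorem pd_eq_zero_of_notMem_tsupport {x : EuclideanSpace ℝ (Fin N)} (hx : x ∉ tsupport f)
    (i : Fin N) : pd i f x = 0 :=
  image_eq_zero_of_notMem_tsupport fun h => hx (tsupport_pd_subset f i h)

theorem lap_eq_zero_of_notMem_tsupport {x : EuclideanSpace ℝ (Fin N)} (hx : x ∉ tsupport f) :
    lap f x = 0 :=
  Finset.sum_eq_zero fun i _ =>
    pd_eq_zero_of_notMem_tsupport (fun h => hx (tsupport_pd_subset f i h)) i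

theorem gdot_eq_zero_of_notMem_tsupport {x : EuclideanSpace ℝ (Fin N)} (hx : x ∉ tsupport f) :
    gdot f g x = 0 :=
  Finset.sum_eq_zero fun i _ => by rw [pd_eq_zero_of_notMem_tsupport hx, zero_mul]

theorem hasCompactSupport_lap (hf : HasCompactSupport f) : HasCompactSupport (lap f) :=
  HasCompactSupport.intro hf fun _ hx => lap_eq_zero_of_notMem_tsupport hx

theorem hasCompactSupport_gdot (hf : HasCompactSupport f) : HasCompactSupport (gdot f g) :=
  HasCompactSupport.intro hf fun _ hx => gdot_eq_zero_of_notMem_tsupport hx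

theorem integral_mul_pd (hf : ContDiff ℝ 1 f) (hg : ContDiff ℝ 1 g) (hc : HasCompactSupport f)
    (i : Fin N) : ∫ x, f x * pd i g x = -∫ x, pd i f x * g x := by
  refine integral_mul_fderiv_eq_neg_fderiv_mul_of_integrable ?_ ?_ ?_ ?_ ?_
  · exact ((continuous_pd hf i).mul hg.continuous).integrable_of_hasCompactSupport
      (hasCompactSupport_pd hc i).mul_right
  · exact (hf.continuous.mul (continuous_pd hg i)).integrable_of_hasCompactSupport hc.mul_right
  · exact (hf.continuous.mul hg.continuous).integrable_of_hasCompactSupport hc.mul_right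
  · exact fun x _ => hf.differentiable (by norm_num) x
  · exact fun x _ => hg.differentiable (by norm_num) x

/-- The first Green identity. -/
theorem integral_gdot (hf : ContDiff ℝ 1 f) (hg : ContDiff ℝ 2 g) (hc : HasCompactSupport f) :
    ∫ x, gdot f g x = -∫ x, f x * lap g x := by
  have hg1 : ∀ i, ContDiff ℝ 1 (pd i g) := fun i => contDiff_pd hg (by norm_num) i
  simp only [gdot, lap_eq_sum_pd, Finset.mul_sum]
  rw [integral_finsetSum, integral_finsetSum, ← Finset.sum_neg_distrib]
  · exact Finset.sum_congr rfl fun i _ => by rw [integral_mul_pd hf (hg1 i) hc i, neg_neg]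
  · exact fun i _ => (hf.continuous.mul
      (continuous_pd (hg1 i) i)).integrable_of_hasCompactSupport hc.mul_right
  · exact fun i _ => ((continuous_pd hf i).mul
      (hg1 i).continuous).integrable_of_hasCompactSupport (hasCompactSupport_pd hc i).mul_right

theorem integral_gdot' (hf : ContDiff ℝ 1 f) (hg : ContDiff ℝ 2 g) (hc : HasCompactSupport g) :
    ∫ x, gdot f g x = -∫ x, f x * lap g x := by
  have hg1 : ∀ i, ContDiff ℝ 1 (pd i g) := fun i => contDiff_pd hg (by norm_num) i
  simp only [gdot, lap_eq_sum_pd, Finset.mul_sum]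
  rw [integral_finsetSum, integral_finsetSum, ← Finset.sum_neg_distrib]
  · refine Finset.sum_congr rfl fun i _ => ?_
    have := integral_mul_pd (hg1 i) hf (hasCompactSupport_pd hc i) i
    simp only [mul_comm (pd i g _)] at this
    rw [this]; simp only [mul_comm]
  · exact fun i _ => (hf.continuous.mul
      (continuous_pd (hg1 i) i)).integrable_of_hasCompactSupport
        (hasCompactSupport_pd (hasCompactSupport_pd hc i) i).mul_left
  · exact fun i _ => ((continuous_pd hf i).mul
      (hg1 i).continuous).integrable_of_hasCompactSupport (hasCompactSupport_pd hc i).mul_left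

/-- The second Green identity. -/
theorem integral_mul_lap_comm (hf : ContDiff ℝ 2 f) (hg : ContDiff ℝ 2 g)
    (hc : HasCompactSupport g) : ∫ x, f x * lap g x = ∫ x, g x * lap f x := by
  have h1 := integral_gdot' (hf.of_le (by norm_num)) hg hc
  have h2 := integral_gdot (hg.of_le (by norm_num)) hf hc
  simp only [gdot_comm f g] at h1
  linarith

end Calculus

section MaximumPrinciple

variable {N : ℕ} {f g : EuclideanSpace ℝ (Fin N) → ℝ}

theorem deriv_deriv_nonpos_of_isLocalMax {g : ℝ → ℝ} {a : ℝ} (hg : ContinuousAt g a)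
    (h : IsLocalMax g a) : deriv (deriv g) a ≤ 0 := by
  by_contra! hpos
  have hmin := isLocalMin_of_deriv_deriv_pos hpos h.deriv_eq_zero hg
  have hconst : g =ᶠ[nhds a] fun _ => g a := by
    filter_upwards [h, hmin] with x h1 h2 using le_antisymm h1 h2
  have := hconst.deriv.deriv_eq
  simp at this
  linarith

theorem pd_eq_deriv (hf : Differentiable ℝ f) (i : Fin N) (x : EuclideanSpace ℝ (Fin N)) (t : ℝ) :
    pd i f (x + t • EuclideanSpace.single i 1)
      = deriv (fun s : ℝ => f (x + s • EuclideanSpace.single i 1)) t := by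
  have h1 : HasDerivAt (fun s : ℝ => x + s • EuclideanSpace.single i (1 : ℝ))
      (EuclideanSpace.single i 1) t := by
    simpa using ((hasDerivAt_id t).smul_const (EuclideanSpace.single i (1 : ℝ))).const_add x
  exact ((hf _).hasFDerivAt.comp_hasDerivAt t h1).deriv.symm

theorem lap_nonpos_of_isLocalMax (hf : ContDiff ℝ 2 f) {x : EuclideanSpace ℝ (Fin N)}
    (h : IsLocalMax f x) : lap f x ≤ 0 := by
  refine Finset.sum_nonpos fun i _ => ?_
  have hf1 := hf.differentiable (by norm_num)
  have hf2 := (contDiff_pd hf (m := 1) (by norm_num) i).differentiable (by norm_num)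
  set L : ℝ → EuclideanSpace ℝ (Fin N) := fun s => x + s • EuclideanSpace.single i (1 : ℝ) with hL
  have hLc : Continuous L := by fun_prop
  have hL0 : L 0 = x := by simp [hL]
  have h1 : deriv (fun s => f (L s)) = fun s => pd i f (L s) :=
    funext fun s => (pd_eq_deriv hf1 i x s).symm
  have h2 : deriv (deriv (fun s => f (L s))) 0 = pd i (pd i f) x := by
    rw [h1, ← pd_eq_deriv hf2 i x 0]; simp
  change pd i (pd i f) x ≤ 0
  rw [← h2]
  refine deriv_deriv_nonpos_of_isLocalMax (hf.continuous.comp hLc).continuousAt ?_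
  rw [← hL0] at h
  exact h.comp_continuous hLc.continuousAt

theorem pd_eq_zero_of_isLocalMax {x : EuclideanSpace ℝ (Fin N)}
    (h : IsLocalMax f x) (i : Fin N) : pd i f x = 0 := by
  simp [pd, h.fderiv_eq_zero]

theorem pd_sq_dist (a x : EuclideanSpace ℝ (Fin N)) (b c : ℝ) (i : Fin N) :
    pd i (fun y => b - c * ‖y - a‖ ^ 2) x = -(2 * c) * (x i - a i) := by
  have h : HasFDerivAt (fun y : EuclideanSpace ℝ (Fin N) => b - c * ‖y - a‖ ^ 2)
      (-(c • (2 • (innerSL ℝ (x - a)).comp (ContinuousLinearMap.id ℝ _)))) x :=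
    ((((hasFDerivAt_id x).sub_const a).norm_sq).const_mul c).const_sub b
  rw [pd, h.fderiv]
  simp [EuclideanSpace.inner_single_right]
  ring

theorem lap_sq_dist (a x : EuclideanSpace ℝ (Fin N)) (b c : ℝ) :
    lap (fun y => b - c * ‖y - a‖ ^ 2) x = -(2 * c) * N := by
  have h : ∀ i : Fin N, pd i (fun y : EuclideanSpace ℝ (Fin N) => b - c * ‖y - a‖ ^ 2)
      = fun y => -(2 * c) * (y i - a i) := fun i => funext fun y => pd_sq_dist a y b c i
  have h2 : ∀ i : Fin N, pd i (fun y : EuclideanSpace ℝ (Fin N) => -(2 * c) * (y i - a i)) x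
      = -(2 * c) := fun i => by
    have : HasFDerivAt (fun y : EuclideanSpace ℝ (Fin N) => -(2 * c) * (y i - a i))
        ((-(2 * c)) • (EuclideanSpace.proj i : EuclideanSpace ℝ (Fin N) →L[ℝ] ℝ)) x :=
      (((EuclideanSpace.proj i : EuclideanSpace ℝ (Fin N) →L[ℝ] ℝ).hasFDerivAt).sub_const
        (a i)).const_mul _
    rw [pd, this.fderiv]
    simp
  simp only [lap_eq_sum_pd, h, h2]
  simp [mul_comm]

theorem gdot_sq_dist (a x : EuclideanSpace ℝ (Fin N)) (b c : ℝ) :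
    gdot (fun y => b - c * ‖y - a‖ ^ 2) (fun y => b - c * ‖y - a‖ ^ 2) x
      = 4 * c ^ 2 * ‖x - a‖ ^ 2 := by
  simp only [gdot, pd_sq_dist]
  rw [EuclideanSpace.norm_sq_eq, Finset.mul_sum]
  refine Finset.sum_congr rfl fun i _ => ?_
  simp only [PiLp.sub_apply, Real.norm_eq_abs, sq_abs]
  ring

/-- At a maximum of `w η^(n+2)`, the Laplacian of `w` is controlled by the derivatives of `η`. -/
theorem sq_mul_lap_le_of_isLocalMax {w η : EuclideanSpace ℝ (Fin N) → ℝ} (hw : ContDiff ℝ 2 w)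
    (hη : ContDiff ℝ 2 η) (n : ℕ) {x : EuclideanSpace ℝ (Fin N)} (hηx : 0 < η x)
    (h : IsLocalMax (fun y => w y * η y ^ (n + 2)) x) :
    η x ^ 2 * lap w x
      ≤ w x * ((n + 2) * (n + 3) * gdot η η x - (n + 2) * (η x * lap η x)) := by
  have hw1 := hw.differentiable (by norm_num)
  have hη1 := hη.differentiable (by norm_num)
  have hη2 : ContDiff ℝ 2 (fun y => η y ^ (n + 2)) := hη.pow _
  have hg : ∀ i, η x * pd i w x = -((n + 2) * w x * pd i η x) := by
    intro i
    have h0 := pd_eq_zero_of_isLocalMax h i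
    rw [pd_mul (hw1 x) (hη2.differentiable (by norm_num) x), pd_pow _ (hη1 x)] at h0
    have h1 : η x ^ (n + 1) * (η x * pd i w x + (n + 2) * w x * pd i η x) = 0 := by
      rw [← h0, show n + 2 - 1 = n + 1 by omega]; push_cast; ring
    have := (mul_eq_zero.1 h1).resolve_left (pow_pos hηx _).ne'
    linarith
  have hgw : η x * gdot w (fun y => η y ^ (n + 2)) x
      = -((n + 2) ^ 2 * η x ^ (n + 1) * w x * gdot η η x) := by
    simp only [gdot, Finset.mul_sum, ← Finset.sum_neg_distrib]
    refine Finset.sum_congr rfl fun i _ => ?_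
    rw [pd_pow _ (hη1 x), ← mul_assoc, hg i, show n + 2 - 1 = n + 1 by omega]
    push_cast
    ring
  have hlap := lap_nonpos_of_isLocalMax (hw.mul hη2) h
  rw [lap_mul hw hη2, lap_pow n hη] at hlap
  have h3 : η x ^ (n + 1) * (η x ^ 2 * lap w x
      - w x * ((n + 2) * (n + 3) * gdot η η x - (n + 2) * (η x * lap η x))) ≤ 0 := by
    have := mul_nonpos_of_nonneg_of_nonpos hηx.le hlap
    refine le_of_eq_of_le ?_ this
    linear_combination (-2) * hgw
  have := nonpos_of_mul_nonpos_right h3 (pow_pos hηx _)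
  linarith

/-- A Keller–Osserman type theorem: entire solutions of `Δw ≥ c w^(1+θ)` on `{w > 0}` are
nonpositive. -/
theorem nonpos_of_superlinear_lap {w : EuclideanSpace ℝ (Fin N) → ℝ} (hw : ContDiff ℝ 2 w)
    {c θ : ℝ} (hc : 0 < c) (hθ : 0 < θ) (h : ∀ x, 0 < w x → c * (w x * w x ^ θ) ≤ lap w x)
    (a : EuclideanSpace ℝ (Fin N)) : w a ≤ 0 := by
  by_contra! ha
  obtain ⟨n, hn⟩ := exists_nat_ge (2 / θ)
  have hnθ : 2 ≤ ((n + 2 : ℕ) : ℝ) * θ := by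
    rw [div_le_iff₀ hθ] at hn
    push_cast; nlinarith
  set K : ℝ := 4 * ((n + 2) * (n + 3)) + 2 * (n + 2) * N with hK
  have key : ∀ R : ℝ, 0 < R → c * w a ^ θ ≤ K / R ^ 2 := by
    intro R hR
    set η : EuclideanSpace ℝ (Fin N) → ℝ := fun y => 1 - (R ^ 2)⁻¹ * ‖y - a‖ ^ 2 with hηdef
    have hη : ContDiff ℝ 2 η :=
      contDiff_const.sub (contDiff_const.mul ((contDiff_id.sub contDiff_const).norm_sq ℝ))
    set H : EuclideanSpace ℝ (Fin N) → ℝ := fun y => w y * η y ^ (n + 2)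
    have hH : ContDiff ℝ 2 H := hw.mul (hη.pow _)
    obtain ⟨x, hx, hmax⟩ := (isCompact_closedBall a R).exists_isMaxOn
      ⟨a, Metric.mem_closedBall_self hR.le⟩ hH.continuous.continuousOn
    have hηa : η a = 1 := by simp [hηdef]
    have hHa : H a = w a := by simp [H, hηa]
    have hHx : w a ≤ H x := hHa ▸ hmax (Metric.mem_closedBall_self hR.le)
    have hxR : ‖x - a‖ ≤ R := by simpa [dist_eq_norm] using hx
    have hR2 : 0 < (R ^ 2)⁻¹ := by positivity
    have hsq : (R ^ 2)⁻¹ * ‖x - a‖ ^ 2 ≤ 1 := by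
      rw [inv_mul_le_iff₀ (by positivity), mul_one]
      exact pow_le_pow_left₀ (norm_nonneg _) hxR 2
    have hη0 : 0 ≤ η x := by simp only [hηdef]; linarith
    have hη1 : η x ≤ 1 := by
      have : 0 ≤ (R ^ 2)⁻¹ * ‖x - a‖ ^ 2 := by positivity
      simp only [hηdef]; linarith
    have hηx : 0 < η x := by
      refine lt_of_le_of_ne hη0 fun h0 => ?_
      have : H x = 0 := by simp [H, ← h0]
      linarith
    have hwx : 0 < w x := by
      have : 0 < w x * η x ^ (n + 2) := lt_of_lt_of_le ha hHx
      exact (pos_iff_pos_of_mul_pos this).2 (pow_pos hηx _)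
    have hxlt : ‖x - a‖ < R := by
      refine lt_of_le_of_ne hxR fun h0 => ?_
      simp only [hηdef, h0] at hηx
      rw [inv_mul_cancel₀ (by positivity)] at hηx
      simp at hηx
    have hloc : IsLocalMax H x :=
      hmax.isLocalMax (Metric.closedBall_mem_nhds_of_mem (by simpa [dist_eq_norm] using hxlt))
    have h1 := sq_mul_lap_le_of_isLocalMax hw hη n hηx hloc
    have hlap : lap η x = -(2 * (R ^ 2)⁻¹) * N := lap_sq_dist a x 1 _
    have hgd : gdot η η x = 4 * ((R ^ 2)⁻¹) ^ 2 * ‖x - a‖ ^ 2 := gdot_sq_dist a x 1 _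
    have hgd' : gdot η η x ≤ 4 * (R ^ 2)⁻¹ := by
      rw [hgd]; nlinarith
    have hlap' : -(η x * lap η x) ≤ 2 * N * (R ^ 2)⁻¹ := by
      rw [hlap]
      have : 0 ≤ 2 * N * (R ^ 2)⁻¹ := by positivity
      nlinarith
    have h2 : (n + 2) * (n + 3) * gdot η η x - (n + 2) * (η x * lap η x) ≤ K / R ^ 2 := by
      have e1 : ((n : ℝ) + 2) * (n + 3) * gdot η η x ≤ (n + 2) * (n + 3) * (4 * (R ^ 2)⁻¹) := by
        gcongr
      have e2 : ((n : ℝ) + 2) * -(η x * lap η x) ≤ (n + 2) * (2 * N * (R ^ 2)⁻¹) := by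
        gcongr
      rw [hK, div_eq_mul_inv]
      linarith
    have h3 : w x * (c * (w x ^ θ * η x ^ 2)) ≤ w x * (K / R ^ 2) := by
      calc w x * (c * (w x ^ θ * η x ^ 2)) = η x ^ 2 * (c * (w x * w x ^ θ)) := by ring
        _ ≤ η x ^ 2 * lap w x := by gcongr; exact h x hwx
        _ ≤ _ := h1
        _ ≤ _ := by gcongr
    have h4 := le_of_mul_le_mul_left h3 hwx
    have h5 : w a ^ θ ≤ w x ^ θ * η x ^ 2 := by
      calc w a ^ θ ≤ (w x * η x ^ (n + 2)) ^ θ := by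
            exact Real.rpow_le_rpow ha.le hHx hθ.le
        _ = w x ^ θ * η x ^ (((n + 2 : ℕ) : ℝ) * θ) := by
            rw [Real.mul_rpow hwx.le (by positivity), ← Real.rpow_natCast, ← Real.rpow_mul hη0]
        _ ≤ w x ^ θ * η x ^ (2 : ℝ) := by
            gcongr ?_ * ?_
            exact Real.rpow_le_rpow_of_exponent_ge hηx hη1 hnθ
        _ = _ := by rw [Real.rpow_two]
    calc c * w a ^ θ ≤ c * (w x ^ θ * η x ^ 2) := by gcongr
      _ ≤ _ := h4
  have hlim : Filter.Tendsto (fun R : ℝ => K / R ^ 2) Filter.atTop (nhds 0) :=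
    Filter.Tendsto.div_atTop tendsto_const_nhds (Filter.tendsto_pow_atTop (by norm_num))
  have := ge_of_tendsto hlim ((Filter.eventually_gt_atTop 0).mono key)
  have : 0 < c * w a ^ θ := by positivity
  linarith

end MaximumPrinciple

section MeanValue

variable {N : ℕ} {f g : EuclideanSpace ℝ (Fin N) → ℝ}

theorem pd_comp_affine (hf : Differentiable ℝ f) (a : EuclideanSpace ℝ (Fin N)) (r : ℝ) (i : Fin N)
    (y : EuclideanSpace ℝ (Fin N)) :
    pd i (fun y => f (a + r • y)) y = r * pd i f (a + r • y) := by
  have h : HasFDerivAt (fun y : EuclideanSpace ℝ (Fin N) => a + r • y)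
      (r • ContinuousLinearMap.id ℝ _) y := ((hasFDerivAt_id y).const_smul r).const_add a
  have h2 := ((hf (a + r • y)).hasFDerivAt.comp y h).fderiv
  simp only [Function.comp_def] at h2
  simp [pd, h2]

theorem lap_comp_affine (hf : ContDiff ℝ 2 f) (a : EuclideanSpace ℝ (Fin N)) (r : ℝ)
    (y : EuclideanSpace ℝ (Fin N)) :
    lap (fun y => f (a + r • y)) y = r ^ 2 * lap f (a + r • y) := by
  have hf1 := hf.differentiable (by norm_num)
  have hf2 := fun i => (contDiff_pd hf (m := 1) (by norm_num) i).differentiable (by norm_num)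
  have : ∀ i : Fin N, pd i (fun y => f (a + r • y)) = fun y => r * pd i f (a + r • y) :=
    fun i => funext fun y => pd_comp_affine hf1 a r i y
  simp only [lap_eq_sum_pd, this, Finset.mul_sum]
  refine Finset.sum_congr rfl fun i _ => ?_
  have hd : Differentiable ℝ fun y => pd i f (a + r • y) :=
    (hf2 i).comp (by fun_prop)
  rw [pd_const_mul _ (hd y), pd_comp_affine (hf2 i)]
  ring

/-- There is a smooth radial cutoff `Ψ` with `∇Ψ(y) = -ψ(y) y` for some weight `ψ ≥ 0`. -/
theorem exists_radial_weight (hN : 0 < N) :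
    ∃ Ψ ψ : EuclideanSpace ℝ (Fin N) → ℝ, ContDiff ℝ (⊤ : ℕ∞) Ψ ∧ ContDiff ℝ (⊤ : ℕ∞) ψ ∧
      HasCompactSupport Ψ ∧ HasCompactSupport ψ ∧ (∀ y, 0 ≤ Ψ y) ∧ (∀ y, 0 ≤ ψ y) ∧
      (∀ i y, pd i Ψ y = -ψ y * y i) ∧ 0 < ∫ y, ψ y := by
  set s : ℝ → ℝ := Real.smoothTransition
  have hs : ContDiff ℝ (⊤ : ℕ∞) s := Real.smoothTransition.contDiff
  have hs' : ContDiff ℝ (⊤ : ℕ∞) (deriv s) := by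
    have := (contDiff_infty_iff_deriv (𝕜 := ℝ) (f := s)).1 hs
    exact this.2
  set q : EuclideanSpace ℝ (Fin N) → ℝ := fun y => 2 - 1 * ‖y - 0‖ ^ 2 with hq
  have hqs : ContDiff ℝ (⊤ : ℕ∞) q :=
    contDiff_const.sub (contDiff_const.mul ((contDiff_id.sub contDiff_const).norm_sq ℝ))
  have hout : ∀ y : EuclideanSpace ℝ (Fin N), y ∉ Metric.closedBall 0 2 → q y < 0 := by
    intro y hy
    simp only [Metric.mem_closedBall, dist_zero_right, not_le] at hy
    simp only [hq, sub_zero]; nlinarith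
  have hds : ∀ t < 0, deriv s t = 0 := by
    intro t ht
    have : s =ᶠ[nhds t] fun _ => 0 := by
      filter_upwards [gt_mem_nhds ht] with x hx
      exact Real.smoothTransition.zero_of_nonpos hx.le
    rw [this.deriv_eq]; simp
  have hmono : Monotone s := Real.smoothTransition.monotone
  have hpd : ∀ i y, pd i (fun y => s (q y)) y = -(2 * deriv s (q y)) * y i := by
    intro i y
    have h1 : HasFDerivAt (fun y => s (q y)) (deriv s (q y) • fderiv ℝ q y) y :=
      ((hs.differentiable (by norm_num)) (q y)).hasDerivAt.comp_hasFDerivAt y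
        ((hqs.differentiable (by norm_num)) y).hasFDerivAt
    have h2 : fderiv ℝ q y (EuclideanSpace.single i 1) =
        -(2 * 1) * (y i - (0 : EuclideanSpace ℝ (Fin N)) i) :=
      pd_sq_dist 0 y 2 1 i
    rw [pd, h1.fderiv, _root_.smul_apply, h2]
    simp; ring
  have hψc : ContDiff ℝ (⊤ : ℕ∞) fun y => 2 * deriv s (q y) := contDiff_const.mul (hs'.comp hqs)
  have hψs : HasCompactSupport fun y => 2 * deriv s (q y) :=
    HasCompactSupport.intro (isCompact_closedBall 0 2) fun y hy => by
      rw [hds _ (hout y hy), mul_zero]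
  have hψ0 : ∀ y, 0 ≤ 2 * deriv s (q y) := fun y => by
    have := hmono.deriv_nonneg (x := q y); positivity
  refine ⟨fun y => s (q y), fun y => 2 * deriv s (q y), hs.comp hqs, hψc,
    HasCompactSupport.intro (isCompact_closedBall 0 2) fun y hy =>
      Real.smoothTransition.zero_of_nonpos (hout y hy).le, hψs,
    fun y => Real.smoothTransition.nonneg _, hψ0, hpd, ?_⟩
  refine lt_of_le_of_ne (integral_nonneg hψ0) fun h0 => ?_
  have hz : (fun y => 2 * deriv s (q y)) = 0 :=
    hψc.continuous.ae_eq_iff_eq volume continuous_zero |>.1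
      ((integral_eq_zero_iff_of_nonneg hψ0
        (hψc.continuous.integrable_of_hasCompactSupport hψs)).1 h0.symm)
  have hconst := pd_eq_deriv (f := fun y => s (q y)) ((hs.comp hqs).differentiable (by norm_num))
    ⟨0, hN⟩ 0
  have hd0 : ∀ t, deriv (fun t : ℝ => s (q (0 + t • EuclideanSpace.single ⟨0, hN⟩ 1))) t = 0 := by
    intro t
    rw [← hconst t, hpd, show 2 * deriv s (q (0 + t • EuclideanSpace.single ⟨0, hN⟩ 1)) = 0 from
      congrFun hz _]
    simp
  have hdiff : Differentiable ℝ
      (fun t : ℝ => s (q (0 + t • EuclideanSpace.single ⟨0, hN⟩ 1))) :=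
    ((hs.comp hqs).differentiable (by norm_num)).comp (by fun_prop)
  have := is_const_of_deriv_eq_zero hdiff hd0 0 3
  have e0 : s (q (0 + (0 : ℝ) • EuclideanSpace.single ⟨0, hN⟩ 1)) = 1 :=
    Real.smoothTransition.one_of_one_le (by simp [hq])
  have e3 : s (q (0 + (3 : ℝ) • EuclideanSpace.single ⟨0, hN⟩ 1)) = 0 :=
    Real.smoothTransition.zero_of_nonpos (by simp [hq, norm_smul]; norm_num)
  simp only [e0, e3] at this
  norm_num at this

/-- Sub-mean value inequality for subharmonic functions with a radial weight. -/
theorem mul_integral_le_of_lap_nonneg {z Ψ ψ : EuclideanSpace ℝ (Fin N) → ℝ}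
    (hz : ContDiff ℝ 2 z) (hlap : ∀ x, 0 ≤ lap z x) (hΨ : ContDiff ℝ 1 Ψ) (hψ : Continuous ψ)
    (hΨc : HasCompactSupport Ψ) (hψc : HasCompactSupport ψ) (hΨ0 : ∀ y, 0 ≤ Ψ y)
    (hgrad : ∀ i y, pd i Ψ y = -ψ y * y i) :
    z 0 * ∫ y, ψ y ≤ ∫ y, z y * ψ y := by
  have hz1 := hz.differentiable (by norm_num)
  set F : ℝ → EuclideanSpace ℝ (Fin N) → ℝ := fun t y => z (t • y) * ψ y
  set F' : ℝ → EuclideanSpace ℝ (Fin N) → ℝ := fun t y => fderiv ℝ z (t • y) y * ψ y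
  have hF'c : Continuous fun q : ℝ × EuclideanSpace ℝ (Fin N) => F' q.1 q.2 := by
    have h1 : Continuous (fderiv ℝ z) := hz.continuous_fderiv (by norm_num)
    have h2 : Continuous fun q : ℝ × EuclideanSpace ℝ (Fin N) => fderiv ℝ z (q.1 • q.2) :=
      h1.comp (by fun_prop)
    exact (h2.clm_apply continuous_snd).mul (hψ.comp continuous_snd)
  have hFc : ∀ t, Continuous (F t) := fun t => by
    have := hz.continuous
    fun_prop
  have hFi : ∀ t, Integrable (F t) := fun t =>
    (hFc t).integrable_of_hasCompactSupport hψc.mul_left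
  have hderiv : ∀ t, HasDerivAt (fun t => ∫ y, F t y) (∫ y, F' t y) t := by
    intro t
    obtain ⟨C, hC⟩ := ((isCompact_closedBall t 1).prod hψc).exists_bound_of_continuousOn
      hF'c.continuousOn
    refine (hasDerivAt_integral_of_dominated_loc_of_deriv_le (s := Metric.ball t 1)
      (bound := (tsupport ψ).indicator fun _ => C)
      (Metric.ball_mem_nhds t one_pos)
      (Filter.Eventually.of_forall fun s => (hFc s).aestronglyMeasurable)
      (hFi t)
      (hF'c.comp (by fun_prop : Continuous fun y => (t, y))).aestronglyMeasurable ?_ ?_ ?_).2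
    · refine Filter.Eventually.of_forall fun y s hs => ?_
      by_cases hy : y ∈ tsupport ψ
      · rw [Set.indicator_of_mem hy]
        exact hC (s, y) ⟨Metric.ball_subset_closedBall hs, hy⟩
      · rw [Set.indicator_of_notMem hy]
        simp [F', image_eq_zero_of_notMem_tsupport hy]
    · exact (integrable_indicator_iff (isClosed_tsupport ψ).measurableSet).2
        (integrableOn_const (hs := hψc.measure_lt_top.ne))
    · refine Filter.Eventually.of_forall fun y s _ => ?_
      have h1 : HasDerivAt (fun s : ℝ => s • y) y s := by
        simpa using (hasDerivAt_id s).smul_const y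
      exact ((hz1 (s • y)).hasFDerivAt.comp_hasDerivAt s h1).mul_const _
  have hnonneg : ∀ t : ℝ, 0 < t → 0 ≤ ∫ y, F' t y := by
    intro t ht
    set Z : EuclideanSpace ℝ (Fin N) → ℝ := fun y => z (0 + t • y)
    have hZ : ContDiff ℝ 2 Z := hz.comp (contDiff_const.add (contDiff_id.const_smul t))
    have h1 : ∀ y, F' t y = -t⁻¹ * gdot Ψ Z y := by
      intro y
      have hy : y = ∑ i, y i • EuclideanSpace.single i (1 : ℝ) := by
        simpa using ((EuclideanSpace.basisFun (Fin N) ℝ).sum_repr y).symm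
      have h2 : fderiv ℝ z (t • y) y = ∑ i, y i * pd i z (t • y) := by
        conv_lhs => rw [hy]
        rw [map_sum]
        simp only [map_smul, smul_eq_mul, pd, ← hy]
      simp only [F', h2, gdot, Finset.mul_sum, Finset.sum_mul]
      refine Finset.sum_congr rfl fun i _ => ?_
      rw [hgrad, pd_comp_affine hz1, zero_add]
      field_simp
    simp only [h1]
    rw [integral_const_mul, integral_gdot hΨ hZ hΨc]
    have : 0 ≤ ∫ y, Ψ y * lap Z y := integral_nonneg fun y => by
      rw [lap_comp_affine hz]
      have := hlap (0 + t • y)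
      have := hΨ0 y
      positivity
    have ht' : 0 < t⁻¹ := inv_pos.2 ht
    nlinarith
  have hmono : MonotoneOn (fun t => ∫ y, F t y) (Set.Ici 0) := by
    refine monotoneOn_of_deriv_nonneg (convex_Ici 0)
      (fun t _ => (hderiv t).continuousAt.continuousWithinAt)
      (fun t _ => (hderiv t).differentiableAt.differentiableWithinAt) fun t ht => ?_
    rw [(hderiv t).deriv]
    rw [interior_Ici] at ht
    exact hnonneg t ht
  have := hmono (Set.self_mem_Ici) (Set.mem_Ici.2 zero_le_one) zero_le_one
  simp only [F, zero_smul, one_smul] at this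
  rwa [integral_const_mul] at this

end MeanValue

section Positivity

theorem two_le_infty : (2 : WithTop ℕ∞) ≤ (⊤ : ℕ∞) := WithTop.coe_le_coe.2 (le_top (a := (2 : ℕ∞)))

theorem infty_add_two_le : ((⊤ : ℕ∞) : WithTop ℕ∞) + 2 ≤ (⊤ : ℕ∞) := le_rfl

theorem infty_add_one_le : ((⊤ : ℕ∞) : WithTop ℕ∞) + 1 ≤ (⊤ : ℕ∞) := le_rfl

variable {N : ℕ} {p : ℝ}

theorem exists_lap_pow_mul {ζ g : EuclideanSpace ℝ (Fin N) → ℝ} (hζ : ContDiff ℝ (⊤ : ℕ∞) ζ)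
    (hg : ContDiff ℝ (⊤ : ℕ∞) g) (hc : HasCompactSupport ζ) (k : ℕ) :
    ∃ g' : EuclideanSpace ℝ (Fin N) → ℝ, ContDiff ℝ (⊤ : ℕ∞) g' ∧ HasCompactSupport g' ∧
      ∀ x, lap (fun y => ζ y ^ (k + 2) * g y) x = ζ x ^ k * g' x := by
  have hζ2 : ContDiff ℝ 2 ζ := hζ.of_le two_le_infty
  have hg2 : ContDiff ℝ 2 g := hg.of_le two_le_infty
  refine ⟨fun x => ζ x * (ζ x * lap g x + 2 * ((k + 2) * gdot ζ g x) + (k + 2) * (g x * lap ζ x))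
    + gdot ζ ζ x * ((k + 2) * (k + 1) * g x), ?_, ?_, ?_⟩
  · have h1 := contDiff_lap hg infty_add_two_le
    have h2 := contDiff_lap hζ infty_add_two_le
    have h3 := contDiff_gdot hζ hg infty_add_one_le
    have h4 := contDiff_gdot hζ hζ infty_add_one_le
    fun_prop
  · exact (hc.mul_right (f' := fun x => ζ x * lap g x + 2 * ((k + 2) * gdot ζ g x)
      + (k + 2) * (g x * lap ζ x))).add ((hasCompactSupport_gdot hc).mul_right
      (f' := fun x => (k + 2) * (k + 1) * g x))
  · intro x
    have h1 : gdot (fun y => ζ y ^ (k + 2)) g x = (k + 2) * ζ x ^ (k + 1) * gdot ζ g x := by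
      simp only [gdot, Finset.mul_sum]
      refine Finset.sum_congr rfl fun i _ => ?_
      rw [pd_pow _ (hζ2.differentiable (by norm_num) x)]
      push_cast
      ring
    rw [lap_mul (hζ2.pow _) hg2, h1, lap_pow _ hζ2]
    ring

theorem mul_pow_mul_le_young {t z a : ℝ} (hp : 1 < p) (ht : 0 < t) (hz0 : 0 ≤ z) (hz1 : z ≤ 1)
    (ha : 0 ≤ a) {n m : ℕ} (hn : 0 < n) (hm : m ≤ n * p) :
    t * z ^ n * a ≤ z ^ m * t ^ p / p + a ^ (p / (p - 1)) / (p / (p - 1)) := by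
  have hpq : p.HolderConjugate (p / (p - 1)) := Real.HolderConjugate.conjExponent hp
  have h1 := Real.young_inequality_of_nonneg (a := t * z ^ n) (b := a) (by positivity) ha hpq
  have h2 : (t * z ^ n) ^ p ≤ z ^ m * t ^ p := by
    rw [Real.mul_rpow ht.le (by positivity), mul_comm]
    gcongr
    rcases hz0.eq_or_lt with rfl | hz
    · rw [zero_pow hn.ne', Real.zero_rpow (by linarith)]
      positivity
    · rw [← Real.rpow_natCast, ← Real.rpow_natCast, ← Real.rpow_mul hz.le]
      exact Real.rpow_le_rpow_of_exponent_ge hz hz1 hm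
  have hp0 : 0 < p := by linarith
  have h3 : (t * z ^ n) ^ p / p ≤ z ^ m * t ^ p / p := by gcongr
  linarith

/-- A local `L¹` bound for positive solutions of `Δ²w = w^p`, uniform in the solution. -/
theorem exists_integral_mul_le_of_solution (hp : 1 < p) {h : EuclideanSpace ℝ (Fin N) → ℝ}
    (hh : Continuous h) (hhc : HasCompactSupport h) :
    ∃ C : ℝ, ∀ w : EuclideanSpace ℝ (Fin N) → ℝ, ContDiff ℝ 4 w → (∀ x, 0 < w x) →
      (∀ x, lap (lap w) x = w x ^ p) → ∫ x, w x * |h x| ≤ C := by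
  obtain ⟨r, hr0, hr⟩ := hhc.isCompact.isBounded.subset_closedBall_lt 0 0
  let b : ContDiffBump (0 : EuclideanSpace ℝ (Fin N)) := ⟨r, r + 1, hr0, by linarith⟩
  set ζ : EuclideanSpace ℝ (Fin N) → ℝ := fun x => b x
  have hζ : ContDiff ℝ (⊤ : ℕ∞) ζ := b.contDiff
  have hζc : HasCompactSupport ζ := b.hasCompactSupport
  obtain ⟨n, hn⟩ := exists_nat_gt (4 / (p - 1))
  have hp1 : 0 < p - 1 := by linarith
  have hn0 : 0 < n := by
    have : (0 : ℝ) < n := lt_of_le_of_lt (by positivity) hn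
    exact_mod_cast this
  have hnp : ((n + 4 : ℕ) : ℝ) ≤ n * p := by
    rw [div_lt_iff₀ hp1] at hn
    push_cast; linarith
  obtain ⟨g₁, hg₁, -, hg₁e⟩ := exists_lap_pow_mul hζ (contDiff_const (c := (1 : ℝ))) hζc (n + 2)
  obtain ⟨g, hg, hgc, hge⟩ := exists_lap_pow_mul hζ hg₁ hζc n
  set χ : EuclideanSpace ℝ (Fin N) → ℝ := fun y => ζ y ^ (n + 4) with hχ
  have hχs : ContDiff ℝ (⊤ : ℕ∞) χ := hζ.pow _
  have hχc : HasCompactSupport χ := by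
    have : χ = fun y => ζ y * ζ y ^ (n + 3) := by ext y; simp only [hχ]; ring
    rw [this]; exact hζc.mul_right
  have hlapχ : lap χ = fun y => ζ y ^ (n + 2) * g₁ y := by
    ext x; rw [← hg₁e]; simp [hχ]
  have hbi : ∀ x, lap (lap χ) x = ζ x ^ n * g x := by rw [hlapχ]; exact hge
  have hq : 0 < p / (p - 1) := by positivity
  have hp0 : 0 < p := by linarith
  have hInt : ∀ f : EuclideanSpace ℝ (Fin N) → ℝ, Continuous f → HasCompactSupport f →
      Integrable fun x => |f x| ^ (p / (p - 1)) / (p / (p - 1)) := fun f hf hfc => by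
    refine Continuous.integrable_of_hasCompactSupport ?_ ?_
    · exact (hf.abs.rpow_const fun _ => Or.inr hq.le).div_const _
    · exact hfc.comp_left (g := fun t => |t| ^ (p / (p - 1)) / (p / (p - 1)))
        (by simp only [abs_zero]; rw [Real.zero_rpow hq.ne', zero_div])
  have hχ2 : ContDiff ℝ 2 χ := hχs.of_le two_le_infty
  set G := ∫ x, |g x| ^ (p / (p - 1)) / (p / (p - 1)) with hG
  set H := ∫ x, |h x| ^ (p / (p - 1)) / (p / (p - 1)) with hH
  refine ⟨G / (p - 1) + H, fun w hw hw0 hweq => ?_⟩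
  have hwp : Continuous fun x => w x ^ p := hw.continuous.rpow_const fun x => Or.inl (hw0 x).ne'
  have hI : Integrable fun x => χ x * w x ^ p :=
    (hχ2.continuous.mul hwp).integrable_of_hasCompactSupport hχc.mul_right
  have hle : ∀ f : EuclideanSpace ℝ (Fin N) → ℝ, Continuous f → HasCompactSupport f →
      ∫ x, w x * ζ x ^ n * |f x| ≤
        (∫ x, χ x * w x ^ p) / p + ∫ x, |f x| ^ (p / (p - 1)) / (p / (p - 1)) := by
    intro f hf hfc
    rw [← integral_div, ← integral_add (hI.div_const _) (hInt f hf hfc)]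
    refine integral_mono ?_ ((hI.div_const _).add (hInt f hf hfc)) fun x => ?_
    · have hζ' := hζ.continuous
      have := hw.continuous
      refine Continuous.integrable_of_hasCompactSupport (by fun_prop) ?_
      exact (hfc.comp_left (g := fun t => |t|) abs_zero).mul_left
    · exact mul_pow_mul_le_young hp (hw0 x) b.nonneg b.le_one (abs_nonneg _) hn0 hnp
  have hw2 : ContDiff ℝ 2 w := hw.of_le (by norm_num)
  have hlw : ContDiff ℝ 2 (lap w) := contDiff_lap hw (by norm_num)
  have e1 : (2 : WithTop ℕ∞) + 2 ≤ (⊤ : ℕ∞) := WithTop.coe_le_coe.2 (le_top (a := (2 + 2 : ℕ∞)))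
  have hlχ : ContDiff ℝ 2 (lap χ) := contDiff_lap hχs e1
  have hI1 : ∫ x, χ x * w x ^ p = ∫ x, w x * ζ x ^ n * g x := by
    have h1 := integral_mul_lap_comm hlw hχ2 hχc
    have h2 := integral_mul_lap_comm hw2 hlχ (hasCompactSupport_lap hχc)
    simp only [hweq] at h1
    rw [← h1]
    simp only [hbi] at h2
    rw [show (∫ x, lap w x * lap χ x) = ∫ x, lap χ x * lap w x from by simp only [mul_comm], ← h2]
    simp only [mul_assoc]
  have hI2 : ∫ x, w x * ζ x ^ n * g x ≤ ∫ x, w x * ζ x ^ n * |g x| := by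
    have hζ' := hζ.continuous
    have := hw.continuous
    have hg' := hg.continuous
    refine integral_mono ?_ ?_ fun x => ?_
    · exact Continuous.integrable_of_hasCompactSupport (by fun_prop) hgc.mul_left
    · exact Continuous.integrable_of_hasCompactSupport (by fun_prop)
        (hgc.comp_left (g := fun t => |t|) abs_zero).mul_left
    · have := (hw0 x).le
      have : 0 ≤ ζ x := b.nonneg
      have := le_abs_self (g x)
      dsimp only
      gcongr
  have hI3 := hle g hg.continuous hgc
  have hI4 := hle h hh hhc
  have hI5 : ∫ x, w x * |h x| = ∫ x, w x * ζ x ^ n * |h x| := by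
    congr 1
    ext x
    by_cases hx : x ∈ tsupport h
    · have : ζ x = 1 := b.one_of_mem_closedBall (hr hx)
      rw [this]; simp
    · rw [image_eq_zero_of_notMem_tsupport hx]; simp
  set I := ∫ x, χ x * w x ^ p
  have hI6 : I / p ≤ G / (p - 1) := by
    have : I ≤ I / p + G := by linarith
    rw [div_le_div_iff₀ hp0 hp1]
    have h2 : I / p * p = I := by field_simp
    nlinarith
  linarith

/-- Positive entire solutions of `Δ²w = w^p` are superharmonic. -/
theorem lap_nonpos_of_solution (hN : 0 < N) (hp : 1 < p) {u : EuclideanSpace ℝ (Fin N) → ℝ}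
    (hu : ContDiff ℝ 4 u) (hpos : ∀ x, 0 < u x) (heq : ∀ x, lap (lap u) x = u x ^ p)
    (a : EuclideanSpace ℝ (Fin N)) : lap u a ≤ 0 := by
  obtain ⟨Ψ, ψ, hΨ, hψ, hΨc, hψc, hΨ0, hψ0, hgrad, hInt⟩ := exists_radial_weight hN
  have hψ2 : ContDiff ℝ 2 ψ := hψ.of_le two_le_infty
  obtain ⟨C, hC⟩ := exists_integral_mul_le_of_solution hp (continuous_lap hψ2)
    (hasCompactSupport_lap hψc)
  have key : ∀ w : EuclideanSpace ℝ (Fin N) → ℝ, ContDiff ℝ 4 w → (∀ x, 0 < w x) →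
      (∀ x, lap (lap w) x = w x ^ p) → lap w 0 * ∫ y, ψ y ≤ C := by
    intro w hw hw0 hweq
    have hw2 : ContDiff ℝ 2 w := hw.of_le (by norm_num)
    have h1 := mul_integral_le_of_lap_nonneg (z := lap w) (contDiff_lap hw (by norm_num))
      (fun x => by rw [hweq]; exact Real.rpow_nonneg (hw0 x).le _)
      (hΨ.of_le (by exact_mod_cast le_top)) hψ.continuous hΨc hψc hΨ0 hgrad
    have h2 := integral_mul_lap_comm hw2 hψ2 hψc
    rw [show (∫ x, ψ x * lap w x) = ∫ x, lap w x * ψ x from by simp only [mul_comm]] at h2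
    have h3 : ∫ x, w x * lap ψ x ≤ ∫ x, w x * |lap ψ x| := by
      have hl := continuous_lap hψ2
      have := hw.continuous
      refine integral_mono ?_ ?_ fun x => ?_
      · exact Continuous.integrable_of_hasCompactSupport (by fun_prop)
          (hasCompactSupport_lap hψc).mul_left
      · exact Continuous.integrable_of_hasCompactSupport (by fun_prop)
          ((hasCompactSupport_lap hψc).comp_left (g := fun t => |t|) abs_zero).mul_left
      · have := (hw0 x).le
        have := le_abs_self (lap ψ x)
        dsimp only
        gcongr
    linarith [hC w hw hw0 hweq]
  have hp1 : 0 < p - 1 := by linarith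
  set b : ℝ := 4 / (p - 1) with hb
  have hb0 : 0 < b := by positivity
  have hu2 : ContDiff ℝ 2 u := hu.of_le (by norm_num)
  have hlu : ContDiff ℝ 2 (lap u) := contDiff_lap hu (by norm_num)
  have hscale : ∀ R : ℝ, 0 < R → R ^ b * (R ^ 2 * lap u a) * ∫ y, ψ y ≤ C := by
    intro R hR
    have haff : ContDiff ℝ 4 fun y : EuclideanSpace ℝ (Fin N) => a + R • y :=
      contDiff_const.add (contDiff_id.const_smul R)
    have hcu : ContDiff ℝ 4 fun y => u (a + R • y) := hu.comp haff
    have hl : lap (fun y => R ^ b * u (a + R • y)) =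
        fun y => (R ^ b * R ^ 2) * lap u (a + R • y) := by
      ext y
      rw [lap_const_mul _ (hcu.of_le (by norm_num)), lap_comp_affine hu2]
      ring
    have hcl : ContDiff ℝ 2 fun y => lap u (a + R • y) := hlu.comp (haff.of_le (by norm_num))
    have := key (fun y => R ^ b * u (a + R • y)) (contDiff_const.mul hcu)
      (fun y => mul_pos (Real.rpow_pos_of_pos hR _) (hpos _)) (fun y => by
        rw [hl, lap_const_mul _ hcl, lap_comp_affine hlu, heq,
          Real.mul_rpow (Real.rpow_nonneg hR.le _) (hpos _).le, ← Real.rpow_mul hR.le,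
          show b * p = b + 4 by rw [hb]; field_simp; ring, Real.rpow_add hR]
        rw [show (4 : ℝ) = ((4 : ℕ) : ℝ) by norm_num, Real.rpow_natCast]
        ring)
    rw [hl] at this
    simpa [mul_assoc] using this
  by_contra! hcon
  set A := lap u a * ∫ y, ψ y with hA
  have hA0 : 0 < A := mul_pos hcon hInt
  have hR1 : (1 : ℝ) ≤ |C| / A + 1 := by have := abs_nonneg C; have : 0 ≤ |C| / A := by positivity
                                         linarith
  have h1 := hscale (|C| / A + 1) (by linarith)
  set R := |C| / A + 1
  have h2 : 1 ≤ R ^ b := Real.one_le_rpow hR1 hb0.le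
  have h3 : R * A = |C| + A := by simp only [R]; field_simp
  have h4 : R * A ≤ R ^ b * (R ^ 2 * lap u a) * ∫ y, ψ y := by
    have : R ^ b * (R ^ 2 * lap u a) * ∫ y, ψ y = R ^ b * R ^ 2 * A := by rw [hA]; ring
    rw [this]
    gcongr
    nlinarith
  linarith [le_abs_self C]

theorem lap_neg_of_solution (hN : 0 < N) (hp : 1 < p) {u : EuclideanSpace ℝ (Fin N) → ℝ}
    (hu : ContDiff ℝ 4 u) (hpos : ∀ x, 0 < u x) (heq : ∀ x, lap (lap u) x = u x ^ p)
    (a : EuclideanSpace ℝ (Fin N)) : lap u a < 0 := by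
  refine lt_of_le_of_ne (lap_nonpos_of_solution hN hp hu hpos heq a) fun h0 => ?_
  have hmax : IsLocalMax (lap u) a := Filter.Eventually.of_forall fun x => by
    rw [h0]; exact lap_nonpos_of_solution hN hp hu hpos heq x
  have h1 := lap_nonpos_of_isLocalMax (contDiff_lap hu (m := 2) (by norm_num)) hmax
  rw [heq] at h1
  exact absurd (Real.rpow_pos_of_pos (hpos a) p) (not_lt.2 h1)

/-- The pointwise comparison of `-Δu` with `u^((p+1)/2)`. -/
theorem rpow_le_neg_lap_of_solution (hN : 0 < N) (hp : 1 < p)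
    {u : EuclideanSpace ℝ (Fin N) → ℝ}
    (hu : ContDiff ℝ 4 u) (hpos : ∀ x, 0 < u x) (heq : ∀ x, lap (lap u) x = u x ^ p)
    (a : EuclideanSpace ℝ (Fin N)) :
    √(2 / (p + 1)) * u a ^ ((p + 1) / 2) ≤ -lap u a := by
  set σ : ℝ := (p + 1) / 2 with hσ
  set l : ℝ := √(2 / (p + 1)) with hl
  have hσ1 : 1 < σ := by rw [hσ]; linarith
  have hl0 : 0 < l := Real.sqrt_pos.2 (by positivity)
  have hl2 : l * l * σ = 1 := by
    rw [hl, Real.mul_self_sqrt (by positivity), hσ]; field_simp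
  have hu2 : ContDiff ℝ 2 u := hu.of_le (by norm_num)
  have hlu : ContDiff ℝ 2 (lap u) := contDiff_lap hu (by norm_num)
  have hus : ContDiff ℝ 2 fun x => u x ^ σ := hu2.rpow_const_of_ne fun x => (hpos x).ne'
  set w : EuclideanSpace ℝ (Fin N) → ℝ := fun x => l * u x ^ σ + lap u x with hw
  have hwc : ContDiff ℝ 2 w := (contDiff_const.mul hus).add hlu
  have hlw : ∀ x, l * σ * u x ^ (σ - 1) * w x ≤ lap w x := by
    intro x
    rw [hw, lap_add (contDiff_const.mul hus) hlu, lap_const_mul _ hus, lap_rpow _ hu2 hpos, heq]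
    have h1 : 0 ≤ l * (σ * (σ - 1) * u x ^ (σ - 2) * gdot u u x) := by
      have := gdot_self_nonneg u x
      have := Real.rpow_nonneg (hpos x).le (σ - 2)
      have : 0 ≤ σ - 1 := by linarith
      positivity
    have h2 : u x ^ p = u x ^ (σ - 1) * u x ^ σ := by
      rw [← Real.rpow_add (hpos x)]; congr 1; rw [hσ]; ring
    rw [h2]
    dsimp only
    linear_combination h1 + (u x ^ (σ - 1) * u x ^ σ) * hl2
  set θ : ℝ := (σ - 1) / σ with hθ
  have hθ0 : 0 < θ := div_pos (by linarith) (by linarith)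
  have key := nonpos_of_superlinear_lap hwc (c := l * σ * (l ^ θ)⁻¹) (by positivity) hθ0
    (fun x hx => by
      refine le_trans ?_ (hlw x)
      have h1 : w x ≤ l * u x ^ σ := by
        have := lap_nonpos_of_solution hN hp hu hpos heq x
        simp only [hw]; linarith
      have h2 : w x ^ θ ≤ l ^ θ * u x ^ (σ - 1) := by
        calc w x ^ θ ≤ (l * u x ^ σ) ^ θ := Real.rpow_le_rpow hx.le h1 hθ0.le
          _ = l ^ θ * u x ^ (σ - 1) := by
            rw [Real.mul_rpow hl0.le (Real.rpow_nonneg (hpos x).le _),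
              ← Real.rpow_mul (hpos x).le]
            congr 2
            rw [hθ]; field_simp
      have hlθ : 0 < l ^ θ := Real.rpow_pos_of_pos hl0 _
      calc l * σ * (l ^ θ)⁻¹ * (w x * w x ^ θ)
          ≤ l * σ * (l ^ θ)⁻¹ * (w x * (l ^ θ * u x ^ (σ - 1))) := by gcongr
        _ = l * σ * u x ^ (σ - 1) * w x := by field_simp) a
  simp only [hw] at key
  linarith

end Positivity

section Resolvent

open scoped SchwartzMap LineDeriv Laplacian

variable {N : ℕ}

theorem lineDerivOp_eq_pd (f : 𝓢(EuclideanSpace ℝ (Fin N), ℝ)) (i : Fin N)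
    (x : EuclideanSpace ℝ (Fin N)) : ∂_{EuclideanSpace.single i (1 : ℝ)} f x = pd i f x := rfl

theorem laplacian_eq_sum_single {F : Type*} [NormedAddCommGroup F] [NormedSpace ℝ F]
    (f : 𝓢(EuclideanSpace ℝ (Fin N), F)) :
    Δ f = ∑ i : Fin N,
      ∂_{EuclideanSpace.single i (1 : ℝ)} (∂_{EuclideanSpace.single i (1 : ℝ)} f) := by
  rw [SchwartzMap.laplacian_eq_sum (EuclideanSpace.basisFun (Fin N) ℝ) f]
  simp only [EuclideanSpace.basisFun_apply]

theorem laplacian_eq_lap (f : 𝓢(EuclideanSpace ℝ (Fin N), ℝ)) (x : EuclideanSpace ℝ (Fin N)) :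
    Δ f x = lap f x := by
  rw [laplacian_eq_sum_single, sum_apply]
  rfl

theorem lineDerivOp_postcompCLM {F G : Type*} [NormedAddCommGroup F] [NormedSpace ℝ F]
    [NormedAddCommGroup G] [NormedSpace ℝ G]
    (L : F →L[ℝ] G) (f : 𝓢(EuclideanSpace ℝ (Fin N), F)) (m : EuclideanSpace ℝ (Fin N)) :
    ∂_{m} (f.postcompCLM L) = (∂_{m} f).postcompCLM L := by
  ext x
  rw [SchwartzMap.lineDerivOp_apply_eq_fderiv, SchwartzMap.postcompCLM_apply,
    SchwartzMap.lineDerivOp_apply_eq_fderiv]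
  have h : HasFDerivAt (fun x => L (f x)) (L.comp (fderiv ℝ f x)) x :=
    L.hasFDerivAt.comp x (f.differentiableAt).hasFDerivAt
  have : ((f.postcompCLM L : 𝓢(EuclideanSpace ℝ (Fin N), G)) : EuclideanSpace ℝ (Fin N) → G) =
    fun x => L (f x) := rfl
  rw [this, h.fderiv]
  rfl

theorem laplacian_postcompCLM {F G : Type*} [NormedAddCommGroup F] [NormedSpace ℝ F]
    [NormedAddCommGroup G] [NormedSpace ℝ G]
    (L : F →L[ℝ] G) (f : 𝓢(EuclideanSpace ℝ (Fin N), F)) :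
    Δ (f.postcompCLM L) = (Δ f).postcompCLM L := by
  simp only [laplacian_eq_sum_single, lineDerivOp_postcompCLM, map_sum]

theorem hasTemperateGrowth_inv_add_sq {a b : ℝ} (ha : 0 < a) (hb : 0 ≤ b) :
    (fun x : EuclideanSpace ℝ (Fin N) => (a + b * ‖x‖ ^ 2)⁻¹).HasTemperateGrowth := by
  have h1 := (Function.hasTemperateGrowth_one_add_norm_sq_rpow
    (H := EuclideanSpace ℝ (Fin N)) (-1)).comp
    ((√(b / a) • ContinuousLinearMap.id ℝ (EuclideanSpace ℝ (Fin N))).hasTemperateGrowth)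
  have h2 := (Function.HasTemperateGrowth.const (E := EuclideanSpace ℝ (Fin N)) a⁻¹).mul h1
  refine (congrArg Function.HasTemperateGrowth (funext fun x => ?_)).mp h2
  have h3 : 0 ≤ b / a := by positivity
  simp only [Pi.mul_apply, Function.comp, _root_.smul_apply, ContinuousLinearMap.id_apply,
    norm_smul, mul_pow, Real.norm_eq_abs, sq_abs, Real.sq_sqrt h3, Real.rpow_neg_one]
  rw [← mul_inv]
  congr 1
  field_simp

/-- Solvability of `δ g - Δg = f` in the Schwartz space. -/
theorem exists_resolvent {δ : ℝ} (hδ : 0 < δ) (f : 𝓢(EuclideanSpace ℝ (Fin N), ℝ)) :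
    ∃ g : 𝓢(EuclideanSpace ℝ (Fin N), ℝ), δ • g - Δ g = f := by
  set m : EuclideanSpace ℝ (Fin N) → ℝ := fun x => (δ + (2 * π) ^ 2 * ‖x‖ ^ 2)⁻¹ with hm
  have hmt : m.HasTemperateGrowth := hasTemperateGrowth_inv_add_sq hδ (by positivity)
  set F : 𝓢(EuclideanSpace ℝ (Fin N), ℂ) := f.postcompCLM Complex.ofRealCLM
  set G : 𝓢(EuclideanSpace ℝ (Fin N), ℂ) := SchwartzMap.fourierMultiplierCLM ℂ m F with hG
  have hnt : (fun x : EuclideanSpace ℝ (Fin N) => ‖x‖ ^ 2).HasTemperateGrowth := by fun_prop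
  have h1 : δ • G - Δ G = F := by
    rw [SchwartzMap.laplacian_eq_fourierMultiplierCLM]
    have hmul : (1 : ℝ) • F =
        SchwartzMap.fourierMultiplierCLM ℂ (δ • m + (2 * π) ^ 2 • ((fun x => ‖x‖ ^ 2) * m)) F := by
      rw [show δ • m + (2 * π) ^ 2 • ((fun x => ‖x‖ ^ 2) * m) = fun _ => (1 : ℝ) from ?_,
        SchwartzMap.fourierMultiplierCLM_const]
      · rfl
      · ext x
        have : δ + (2 * π) ^ 2 * ‖x‖ ^ 2 ≠ 0 := by positivity
        simp only [Pi.add_apply, Pi.smul_apply, Pi.mul_apply, smul_eq_mul, hm]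
        field_simp
    have hadd :
        SchwartzMap.fourierMultiplierCLM ℂ (δ • m + (2 * π) ^ 2 • ((fun x => ‖x‖ ^ 2) * m)) F =
        SchwartzMap.fourierMultiplierCLM ℂ (δ • m) F +
        SchwartzMap.fourierMultiplierCLM ℂ ((2 * π) ^ 2 • ((fun x => ‖x‖ ^ 2) * m)) F := by
      have t1 : (δ • m).HasTemperateGrowth := (Function.HasTemperateGrowth.const δ).mul hmt
      have t2 : ((2 * π) ^ 2 • ((fun x => ‖x‖ ^ 2) * m)).HasTemperateGrowth :=
        (Function.HasTemperateGrowth.const ((2 * π) ^ 2)).mul (hnt.mul hmt)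
      simp only [SchwartzMap.fourierMultiplierCLM_apply]
      rw [SchwartzMap.smulLeftCLM_add t1 t2, _root_.add_apply, FourierTransform.fourierInv_add]
    rw [one_smul] at hmul
    rw [hmul, hadd, SchwartzMap.fourierMultiplierCLM_smul hmt,
      SchwartzMap.fourierMultiplierCLM_smul (hnt.mul hmt), _root_.smul_apply, _root_.smul_apply,
      ← SchwartzMap.fourierMultiplierCLM_fourierMultiplierCLM_apply hnt hmt, neg_smul,
      sub_neg_eq_add]
  refine ⟨G.postcompCLM Complex.reCLM, ?_⟩
  rw [laplacian_postcompCLM]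
  ext x
  have := congrArg Complex.re (DFunLike.congr_fun h1 x)
  simpa [F] using this

end Resolvent

section Heinz

open scoped SchwartzMap LineDeriv Laplacian

theorem apply_iterate_le_of_bounded {S : Type*} [AddCommGroup S] [Module ℝ S]
    (B : LinearMap.BilinForm ℝ S) (hs : ∀ f g, B f g = B g f) (h0 : ∀ f, 0 ≤ B f f)
    (K : S → S) (hK : ∀ f g, B (K f) g = B f (K g)) (ψ : S) {C : ℝ}
    (hC : ∀ n, B (K^[n] ψ) ψ ≤ C) : B (K ψ) ψ ≤ B ψ ψ := by
  have hshift : ∀ m n, B (K^[m] ψ) (K^[n] ψ) = B (K^[m + n] ψ) ψ := by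
    intro m n
    induction n generalizing m with
    | zero => rfl
    | succ n ih =>
      rw [Function.iterate_succ_apply', ← hK, ← Function.iterate_succ_apply' K m, ih]
      rw [show m.succ + n = m + (n + 1) by omega]
  have hcs : ∀ m, B (K^[m] ψ) ψ ^ 2 ≤ B (K^[2 * m] ψ) ψ * B ψ ψ := by
    intro m
    have := LinearMap.BilinForm.apply_mul_apply_le_of_forall_zero_le B h0 (K^[m] ψ) ψ
    rw [hs ψ, hshift] at this
    rw [two_mul]
    nlinarith
  by_contra! hlt
  have hpos : 0 < B ψ ψ := by
    refine lt_of_le_of_ne (h0 ψ) fun h => ?_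
    have := hcs 1
    rw [← h] at this hlt
    simp only [Function.iterate_one] at this
    nlinarith
  set r := B (K ψ) ψ / B ψ ψ with hr
  have hr1 : 1 < r := (one_lt_div hpos).2 hlt
  have hgrow : ∀ k : ℕ, B ψ ψ * r ^ (2 ^ k) ≤ B (K^[2 ^ k] ψ) ψ := by
    intro k
    induction k with
    | zero =>
      simp only [pow_zero, pow_one, Function.iterate_one]
      rw [hr, mul_div_cancel₀ _ hpos.ne']
    | succ k ih =>
      have h1 := hcs (2 ^ k)
      rw [pow_succ' 2 k]
      have h2 : (B ψ ψ * r ^ (2 ^ k)) ^ 2 ≤ B (K^[2 ^ k] ψ) ψ ^ 2 :=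
        pow_le_pow_left₀ (by positivity) ih 2
      have h3 : B ψ ψ * r ^ (2 * 2 ^ k) * B ψ ψ ≤ B (K^[2 * 2 ^ k] ψ) ψ * B ψ ψ := by
        calc _ = (B ψ ψ * r ^ (2 ^ k)) ^ 2 := by ring
          _ ≤ _ := h2.trans h1
      exact le_of_mul_le_mul_right h3 hpos
  obtain ⟨k, hk⟩ := pow_unbounded_of_one_lt (C / B ψ ψ) hr1
  have h4 : r ^ k ≤ r ^ (2 ^ k) := pow_le_pow_right₀ hr1.le Nat.lt_two_pow_self.le
  have h5 := hgrow k
  have h6 := hC (2 ^ k)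
  rw [div_lt_iff₀ hpos] at hk
  nlinarith

variable {N : ℕ}

theorem inner_toLp (f g : 𝓢(EuclideanSpace ℝ (Fin N), ℝ)) :
    inner ℝ (f.toLp 2) (g.toLp 2) = ∫ x, f x * g x := by
  rw [L2.inner_def]
  refine integral_congr_ae ?_
  filter_upwards [f.coeFn_toLp 2, g.coeFn_toLp 2] with x hf hg
  rw [hf, hg]
  simp [mul_comm]

theorem integrable_mul_schwartz (f g : 𝓢(EuclideanSpace ℝ (Fin N), ℝ)) :
    Integrable fun x => f x * g x :=
  (SchwartzMap.pairing (ContinuousLinearMap.mul ℝ ℝ) f g).integrable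

theorem integral_laplacian_mul (f g : 𝓢(EuclideanSpace ℝ (Fin N), ℝ)) :
    ∫ x, Δ f x * g x = -∑ i : Fin N, ∫ x, ∂_{EuclideanSpace.single i (1 : ℝ)} f x *
      ∂_{EuclideanSpace.single i (1 : ℝ)} g x := by
  simp only [laplacian_eq_sum_single, sum_apply, Finset.sum_mul]
  rw [integral_finsetSum _ fun i _ => integrable_mul_schwartz _ _, ← Finset.sum_neg_distrib]
  refine Finset.sum_congr rfl fun i _ => ?_
  rw [SchwartzMap.integral_mul_lineDerivOp_right_eq_neg_left, neg_neg]

/-- The inclusion of the Schwartz space in `L²`. -/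
noncomputable def schwartzToL2 (N : ℕ) : 𝓢(EuclideanSpace ℝ (Fin N), ℝ) →ₗ[ℝ]
    Lp ℝ 2 (volume : Measure (EuclideanSpace ℝ (Fin N))) :=
  (SchwartzMap.toLpCLM ℝ ℝ 2 (volume : Measure (EuclideanSpace ℝ (Fin N)))).toLinearMap

/-- A partial derivative as a linear map on the Schwartz space. -/
noncomputable def schwartzPd {N : ℕ} (i : Fin N) : 𝓢(EuclideanSpace ℝ (Fin N), ℝ) →ₗ[ℝ]
    𝓢(EuclideanSpace ℝ (Fin N), ℝ) :=
  (LineDeriv.lineDerivOpCLM ℝ 𝓢(EuclideanSpace ℝ (Fin N), ℝ)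
    (EuclideanSpace.single i (1 : ℝ))).toLinearMap

/-- The `L²` scalar product on the Schwartz space. -/
noncomputable def schwartzInner (N : ℕ) : LinearMap.BilinForm ℝ 𝓢(EuclideanSpace ℝ (Fin N), ℝ) :=
  (innerₗ (Lp ℝ 2 (volume : Measure (EuclideanSpace ℝ (Fin N))))).compl₁₂
    (schwartzToL2 N) (schwartzToL2 N)

theorem schwartzInner_apply (f g : 𝓢(EuclideanSpace ℝ (Fin N), ℝ)) :
    schwartzInner N f g = ∫ x, f x * g x := inner_toLp f g

/-- The energy form `δ ∫ f g + ∫ ∇f · ∇g` on the Schwartz space. -/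
noncomputable def energyForm (N : ℕ) (δ : ℝ) :
    LinearMap.BilinForm ℝ 𝓢(EuclideanSpace ℝ (Fin N), ℝ) :=
  δ • schwartzInner N + ∑ i : Fin N, (schwartzInner N).compl₁₂ (schwartzPd i) (schwartzPd i)

theorem energyForm_apply (δ : ℝ) (f g : 𝓢(EuclideanSpace ℝ (Fin N), ℝ)) :
    energyForm N δ f g = δ * (∫ x, f x * g x) +
      ∑ i : Fin N, ∫ x, ∂_{EuclideanSpace.single i (1 : ℝ)} f x *
        ∂_{EuclideanSpace.single i (1 : ℝ)} g x := by
  simp [energyForm, schwartzInner_apply, LinearMap.sum_apply, schwartzPd]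

theorem energyForm_eq_integral (δ : ℝ) (f g : 𝓢(EuclideanSpace ℝ (Fin N), ℝ)) :
    energyForm N δ f g = ∫ x, (δ • f - Δ f) x * g x := by
  have : ∀ x, (δ • f - Δ f) x * g x = δ * (f x * g x) - Δ f x * g x := fun x => by
    simp only [_root_.sub_apply, _root_.smul_apply, smul_eq_mul]; ring
  simp only [this]
  rw [integral_sub ((integrable_mul_schwartz f g).const_mul δ) (integrable_mul_schwartz _ g),
    integral_const_mul, integral_laplacian_mul, energyForm_apply]
  ring

theorem integral_mul_sq_le_energyForm {V : EuclideanSpace ℝ (Fin N) → ℝ}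
    (hVs : ContDiff ℝ (⊤ : ℕ∞) V) (hVc : HasCompactSupport V)
    (hV : ∀ f : 𝓢(EuclideanSpace ℝ (Fin N), ℝ), ∫ x, V x ^ 2 * f x ^ 2 ≤ ∫ x, Δ f x ^ 2)
    {δ : ℝ} (hδ : 0 < δ) (φ : 𝓢(EuclideanSpace ℝ (Fin N), ℝ)) :
    ∫ x, V x * φ x ^ 2 ≤ energyForm N δ φ φ := by
  have hVt := hVc.hasTemperateGrowth hVs
  choose T hT using exists_resolvent (N := N) hδ
  set K : 𝓢(EuclideanSpace ℝ (Fin N), ℝ) → 𝓢(EuclideanSpace ℝ (Fin N), ℝ) :=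
    fun f => T (SchwartzMap.smulLeftCLM ℝ V f) with hKdef
  have hDK : ∀ f x, (δ • K f - Δ (K f)) x = V x * f x := fun f x => by
    rw [hKdef, hT, SchwartzMap.smulLeftCLM_apply_apply hVt, smul_eq_mul]
  have hsymm : ∀ f g, energyForm N δ f g = energyForm N δ g f := fun f g => by
    simp only [energyForm_apply, mul_comm]
  have hnn : ∀ f, 0 ≤ energyForm N δ f f := fun f => by
    rw [energyForm_apply]
    exact add_nonneg (mul_nonneg hδ.le (integral_nonneg fun x => mul_self_nonneg _))
      (Finset.sum_nonneg fun i _ => integral_nonneg fun x => mul_self_nonneg _)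
  have hBK : ∀ f g, energyForm N δ (K f) g = ∫ x, V x * f x * g x := fun f g => by
    rw [energyForm_eq_integral]
    simp only [hDK]
  have hK : ∀ f g, energyForm N δ (K f) g = energyForm N δ f (K g) := fun f g => by
    rw [hsymm f, hBK, hBK]
    congr 1; ext x; ring
  have hlap : ∀ f : 𝓢(EuclideanSpace ℝ (Fin N), ℝ),
      ∫ x, Δ f x ^ 2 ≤ ∫ x, (δ • f - Δ f) x ^ 2 := fun f => by
    have h1 : ∀ x, (δ • f - Δ f) x ^ 2 =
        δ ^ 2 * (f x * f x) - 2 * δ * (Δ f x * f x) + Δ f x * Δ f x := fun x => by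
      simp only [_root_.sub_apply, _root_.smul_apply, smul_eq_mul]; ring
    simp only [h1, pow_two (Δ f _)]
    have hA := (integrable_mul_schwartz f f).const_mul (δ ^ 2)
    have hB := (integrable_mul_schwartz (Δ f) f).const_mul (2 * δ)
    have hI : Integrable fun x => δ ^ 2 * (f x * f x) - 2 * δ * (Δ f x * f x) := hA.sub hB
    rw [integral_add hI (integrable_mul_schwartz _ _), integral_sub hA hB,
      integral_const_mul, integral_const_mul, integral_laplacian_mul f f]
    have h2 : 0 ≤ ∫ x, f x * f x := integral_nonneg fun x => mul_self_nonneg _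
    have h3 : 0 ≤ ∑ i : Fin N, ∫ x, ∂_{EuclideanSpace.single i (1 : ℝ)} f x *
      ∂_{EuclideanSpace.single i (1 : ℝ)} f x :=
      Finset.sum_nonneg fun i _ => integral_nonneg fun x => mul_self_nonneg _
    have h4 : 0 ≤ δ ^ 2 * ∫ x, f x * f x := by positivity
    have h5 := mul_nonneg hδ.le h3
    linarith
  have hbd : ∀ n, ∫ x, (δ • K^[n] φ - Δ (K^[n] φ)) x ^ 2 ≤ ∫ x, (δ • φ - Δ φ) x ^ 2 := by
    intro n
    induction n with
    | zero => exact le_rfl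
    | succ n ih =>
      refine le_trans ?_ ih
      rw [Function.iterate_succ_apply']
      simp only [hDK, mul_pow]
      exact (hV _).trans (hlap _)
  have hmain := apply_iterate_le_of_bounded (energyForm N δ) hsymm hnn K hK φ
    (C := (∫ x, (δ • φ - Δ φ) x ^ 2) + ∫ x, φ x * φ x) (fun n => by
      rw [energyForm_eq_integral]
      refine le_trans ?_ (add_le_add_left (hbd n) _)
      simp only [pow_two]
      rw [← integral_add (integrable_mul_schwartz _ _) (integrable_mul_schwartz _ _)]
      refine integral_mono (integrable_mul_schwartz _ _)
        ((integrable_mul_schwartz _ _).add (integrable_mul_schwartz _ _)) fun x => ?_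
      dsimp only [Pi.add_apply]
      nlinarith [sq_nonneg ((δ • K^[n] φ - Δ (K^[n] φ)) x - φ x),
        sq_nonneg ((δ • K^[n] φ - Δ (K^[n] φ)) x), sq_nonneg (φ x)])
  rw [hBK] at hmain
  simpa only [pow_two, mul_assoc] using hmain

end Heinz

section SchwartzExtension

open scoped SchwartzMap LineDeriv Laplacian Topology
open Filter

variable {N : ℕ}

theorem lap_comp_smul_mul {b g : EuclideanSpace ℝ (Fin N) → ℝ} (hb : ContDiff ℝ 2 b)
    (hg : ContDiff ℝ 2 g) (t : ℝ) (x : EuclideanSpace ℝ (Fin N)) :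
    lap (fun y => b (t • y) * g y) x = b (t • x) * lap g x +
      (∑ i, 2 * (t * pd i b (t • x)) * pd i g x) + t ^ 2 * lap b (t • x) * g x := by
  have hbt : ContDiff ℝ 2 fun y => b (t • y) := by fun_prop
  have h1 := fun i => pd_comp_affine (hb.differentiable (by norm_num)) 0 t i x
  have h2 := lap_comp_affine hb 0 t x
  simp only [zero_add] at h1 h2
  rw [lap_mul hbt hg, gdot, h2, Finset.mul_sum]
  simp only [h1]
  have : ∀ i, 2 * (t * pd i b (t • x) * pd i g x) = 2 * (t * pd i b (t • x)) * pd i g x :=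
    fun i => by ring
  simp only [this]
  ring

theorem integral_mul_sq_le_of_schwartz {W : EuclideanSpace ℝ (Fin N) → ℝ} (hWc : Continuous W)
    (hWs : HasCompactSupport W)
    (hW : ∀ φ : EuclideanSpace ℝ (Fin N) → ℝ, ContDiff ℝ (⊤ : ℕ∞) φ → HasCompactSupport φ →
      ∫ x, W x * φ x ^ 2 ≤ ∫ x, lap φ x ^ 2) (g : 𝓢(EuclideanSpace ℝ (Fin N), ℝ)) :
    ∫ x, W x * g x ^ 2 ≤ ∫ x, Δ g x ^ 2 := by
  let b : ContDiffBump (0 : EuclideanSpace ℝ (Fin N)) := ⟨1, 2, one_pos, one_lt_two⟩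
  have hb : ContDiff ℝ (⊤ : ℕ∞) b := b.contDiff
  have hb2 : ContDiff ℝ 2 b := b.contDiff
  have hgs : ContDiff ℝ (⊤ : ℕ∞) g := g.smooth _
  have hg2 : ContDiff ℝ 2 g := g.smooth _
  set t : ℕ → ℝ := fun n => 1 / ((n : ℝ) + 1) with ht
  have ht0 : ∀ n, 0 < t n := fun n => Nat.one_div_pos_of_nat
  have ht1 : ∀ n, t n ≤ 1 := fun n => by
    rw [ht]; exact (div_le_one (by positivity)).2 (by linarith [(Nat.cast_nonneg n : (0 : ℝ) ≤ n)])
  have htl : Tendsto t atTop (𝓝 0) := tendsto_one_div_add_atTop_nhds_zero_nat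
  have htx : ∀ x : EuclideanSpace ℝ (Fin N), Tendsto (fun n => t n • x) atTop (𝓝 0) := fun x => by
    simpa using htl.smul_const x
  have hpd : ∀ i, Continuous (pd i b) := fun i => continuous_pd (hb2.of_le (by norm_num)) i
  obtain ⟨C, hC⟩ : ∃ C, ∀ i x, |pd i b x| ≤ C := by
    choose c hc using fun i => (hpd i).bounded_above_of_compact_support
      (hasCompactSupport_pd b.hasCompactSupport i)
    refine ⟨∑ i, |c i|, fun i x => (hc i x).trans ((le_abs_self _).trans
      (Finset.single_le_sum (f := fun i => |c i|) (fun j _ => abs_nonneg _) (Finset.mem_univ i)))⟩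
  obtain ⟨D, hD⟩ := (continuous_lap hb2).bounded_above_of_compact_support
    (hasCompactSupport_lap b.hasCompactSupport)
  set χ : ℕ → EuclideanSpace ℝ (Fin N) → ℝ := fun n y => b (t n • y) * g y with hχ
  have hχs : ∀ n, ContDiff ℝ (⊤ : ℕ∞) (χ n) := fun n =>
    (hb.comp (contDiff_const_smul (t n))).mul hgs
  have hχc : ∀ n, HasCompactSupport (χ n) := fun n =>
    (b.hasCompactSupport.comp_smul (ht0 n).ne').mul_right
  have hbl : ∀ x : EuclideanSpace ℝ (Fin N), Tendsto (fun n => b (t n • x)) atTop (𝓝 1) :=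
    fun x => by
      have := (b.continuous.tendsto 0).comp (htx x)
      rwa [b.one_of_mem_closedBall (Metric.mem_closedBall_self b.rIn_pos.le)] at this
  have hb1 : ∀ x, |b x| ≤ 1 := fun x => by
    rw [abs_of_nonneg b.nonneg]; exact b.le_one
  have hL : Tendsto (fun n => ∫ x, W x * χ n x ^ 2) atTop (𝓝 (∫ x, W x * g x ^ 2)) := by
    refine tendsto_integral_of_dominated_convergence (fun x => |W x * g x ^ 2|) (fun n => ?_) ?_
      (fun n => ?_) ?_
    · exact (hWc.mul ((hχs n).continuous.pow 2)).aestronglyMeasurable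
    · exact ((hWc.mul (g.continuous.pow 2)).integrable_of_hasCompactSupport hWs.mul_right).abs
    · refine Eventually.of_forall fun x => ?_
      rw [hχ, Real.norm_eq_abs, mul_pow, mul_left_comm, abs_mul]
      refine mul_le_of_le_one_left (abs_nonneg _) ?_
      rw [abs_pow]
      exact pow_le_one₀ (abs_nonneg _) (hb1 _)
    · refine Eventually.of_forall fun x => ?_
      have := ((hbl x).mul_const (g x)).pow 2 |>.const_mul (W x)
      simpa using this
  have hR : Tendsto (fun n => ∫ x, lap (χ n) x ^ 2) atTop (𝓝 (∫ x, Δ g x ^ 2)) := by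
    set F : EuclideanSpace ℝ (Fin N) → ℝ := fun x =>
      |lap g x| + (∑ i, 2 * C * |pd i g x|) + D * |g x| with hF
    have hFm : MemLp F 2 volume := by
      refine MemLp.add (MemLp.add ?_ (memLp_finsetSum _ fun i _ => ?_)) ?_
      · have := ((Δ g).memLp 2 volume).abs
        have e : (fun x => |lap g x|) = |⇑(Δ g : 𝓢(EuclideanSpace ℝ (Fin N), ℝ))| :=
          funext fun x => by rw [← laplacian_eq_lap]; rfl
        rwa [e]
      · exact ((∂_{EuclideanSpace.single i (1 : ℝ)} g).memLp 2 volume).abs.const_mul (2 * C)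
      · exact (g.memLp 2 volume).abs.const_mul D
    refine tendsto_integral_of_dominated_convergence (fun x => F x ^ 2) (fun n => ?_)
      hFm.integrable_sq (fun n => ?_) ?_
    · exact ((continuous_lap ((hχs n).of_le two_le_infty)).pow 2).aestronglyMeasurable
    · refine Eventually.of_forall fun x => ?_
      rw [Real.norm_eq_abs, abs_pow, hχ, lap_comp_smul_mul hb2 hg2]
      refine pow_le_pow_left₀ (abs_nonneg _) ?_ 2
      refine (abs_add_three _ _ _).trans (add_le_add_three ?_ ?_ ?_)
      · rw [abs_mul]; exact mul_le_of_le_one_left (abs_nonneg _) (hb1 _)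
      · refine (Finset.abs_sum_le_sum_abs _ _).trans (Finset.sum_le_sum fun i _ => ?_)
        rw [abs_mul, abs_mul, abs_mul, abs_two, abs_of_pos (ht0 n)]
        refine mul_le_mul_of_nonneg_right (mul_le_mul_of_nonneg_left ?_ two_pos.le) (abs_nonneg _)
        exact (mul_le_of_le_one_left (abs_nonneg _) (ht1 n)).trans (hC i _)
      · rw [abs_mul, abs_mul, abs_pow, abs_of_pos (ht0 n)]
        refine mul_le_mul_of_nonneg_right ?_ (abs_nonneg _)
        exact (mul_le_of_le_one_left (abs_nonneg _) (pow_le_one₀ (ht0 n).le (ht1 n))).trans (hD _)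
    · refine Eventually.of_forall fun x => ?_
      rw [laplacian_eq_lap]
      refine Tendsto.pow ?_ 2
      simp only [hχ, lap_comp_smul_mul hb2 hg2]
      have e1 : Tendsto (fun n => ∑ i, 2 * (t n * pd i b (t n • x)) * pd i g x) atTop (𝓝 0) := by
        have : Tendsto (fun n => ∑ i, 2 * (t n * pd i b (t n • x)) * pd i g x) atTop
            (𝓝 (∑ i : Fin N, 2 * (0 * pd i b 0) * pd i g x)) :=
          tendsto_finsetSum _ fun i _ => ((htl.mul (((hpd i).tendsto 0).comp (htx x))).const_mul
            2).mul_const _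
        simpa using this
      have e2 := ((htl.pow 2).mul (((continuous_lap hb2).tendsto 0).comp (htx x))).mul_const (g x)
      have e3 := ((hbl x).mul_const (lap g x)).add e1 |>.add e2
      simpa using e3
  exact le_of_tendsto_of_tendsto' hL hR fun n => hW _ (hχs n) (hχc n)

/-- A potential version of the Heinz inequality: `V² ≤ Δ²` implies `V ≤ -Δ`. -/
theorem integral_mul_sq_le_integral_gdot {V : EuclideanSpace ℝ (Fin N) → ℝ} (hVc : Continuous V)
    (hV0 : ∀ x, 0 < V x)
    (hV : ∀ φ : EuclideanSpace ℝ (Fin N) → ℝ, ContDiff ℝ (⊤ : ℕ∞) φ → HasCompactSupport φ →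
      ∫ x, V x ^ 2 * φ x ^ 2 ≤ ∫ x, lap φ x ^ 2)
    {φ : EuclideanSpace ℝ (Fin N) → ℝ} (hφ : ContDiff ℝ (⊤ : ℕ∞) φ) (hφc : HasCompactSupport φ) :
    ∫ x, V x * φ x ^ 2 ≤ ∫ x, gdot φ φ x := by
  have hInt : ∀ {W : EuclideanSpace ℝ (Fin N) → ℝ}, Continuous W →
      ∀ {f : EuclideanSpace ℝ (Fin N) → ℝ}, Continuous f → HasCompactSupport f →
      Integrable fun x => W x * f x ^ 2 := fun hW f hf hfc =>
    (hW.mul (hf.pow 2)).integrable_of_hasCompactSupport (by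
      have : HasCompactSupport fun x => f x ^ 2 := hfc.comp_left (g := fun y : ℝ => y ^ 2) (by simp)
      exact this.mul_left)
  have key : ∀ δ ∈ Set.Ioo (0 : ℝ) (1 / 2), (1 - 2 * δ) * ∫ x, V x * φ x ^ 2 ≤
      δ * (∫ x, φ x ^ 2) + ∫ x, gdot φ φ x := by
    rintro δ ⟨hδ0, hδ1⟩
    obtain ⟨g, hg, hgV, -⟩ := ((hVc.const_mul (1 - δ))).exists_contDiff_approx ⊤
      (ε := fun x => δ * V x) (hVc.const_mul δ) (fun x => mul_pos hδ0 (hV0 x))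
    have hg1 : ∀ x, (1 - 2 * δ) * V x ≤ g x := fun x => by
      have := (abs_lt.1 (Real.dist_eq _ _ ▸ hgV x)).1; linarith
    have hg2 : ∀ x, g x ≤ V x := fun x => by
      have := (abs_lt.1 (Real.dist_eq _ _ ▸ hgV x)).2; linarith
    have hg0 : ∀ x, 0 ≤ g x := fun x =>
      (mul_nonneg (by linarith) (hV0 x).le).trans (hg1 x)
    obtain ⟨r, hr0, hr⟩ := hφc.isCompact.isBounded.subset_closedBall_lt 0 0
    let b : ContDiffBump (0 : EuclideanSpace ℝ (Fin N)) := ⟨r, r + 1, hr0, by linarith⟩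
    have hbs : ContDiff ℝ (⊤ : ℕ∞) b := b.contDiff
    have hWs : ContDiff ℝ (⊤ : ℕ∞) fun x => b x * g x := hbs.mul hg
    have hWc : HasCompactSupport fun x => b x * g x := b.hasCompactSupport.mul_right
    have hWW : HasCompactSupport fun x => (b x * g x) ^ 2 :=
      hWc.comp_left (g := fun y : ℝ => y ^ 2) (by simp)
    have h1 : ∀ f : 𝓢(EuclideanSpace ℝ (Fin N), ℝ),
        ∫ x, (b x * g x) ^ 2 * f x ^ 2 ≤ ∫ x, Δ f x ^ 2 :=
      integral_mul_sq_le_of_schwartz (hWs.continuous.pow 2) hWW fun ψ hψ hψc => by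
        refine (integral_mono (hInt (hWs.continuous.pow 2) hψ.continuous hψc)
          (hInt (hVc.pow 2) hψ.continuous hψc) fun x => ?_).trans (hV ψ hψ hψc)
        refine mul_le_mul_of_nonneg_right (pow_le_pow_left₀ (mul_nonneg b.nonneg (hg0 x)) ?_ 2)
          (sq_nonneg _)
        exact (mul_le_of_le_one_left (hg0 x) b.le_one).trans (hg2 x)
    have h2 := integral_mul_sq_le_energyForm hWs hWc h1 hδ0 (hφc.toSchwartzMap hφ)
    rw [energyForm_apply] at h2
    have h3 : ∀ x, b x * g x * φ x ^ 2 = g x * φ x ^ 2 := fun x => by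
      by_cases hx : x ∈ tsupport φ
      · rw [b.one_of_mem_closedBall (hr hx), one_mul]
      · rw [image_eq_zero_of_notMem_tsupport hx]; simp
    have h4 : (hφc.toSchwartzMap hφ : EuclideanSpace ℝ (Fin N) → ℝ) = φ := by
      ext x; rfl
    simp only [lineDerivOp_eq_pd, h4, h3] at h2
    have hi : ∀ i ∈ (Finset.univ : Finset (Fin N)), Integrable fun x => pd i φ x * pd i φ x :=
      fun i _ => ((continuous_pd (hφ.of_le (by simp)) i).mul
        (continuous_pd (hφ.of_le (by simp)) i)).integrable_of_hasCompactSupport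
        (hasCompactSupport_pd hφc i).mul_right
    rw [← integral_finsetSum _ hi] at h2
    simp only [← pow_two (φ _)] at h2
    refine le_trans ?_ h2
    rw [← integral_const_mul]
    refine integral_mono ((hInt hVc hφ.continuous hφc).const_mul _)
      (hInt hg.continuous hφ.continuous hφc) fun x => ?_
    dsimp only
    rw [← mul_assoc]
    exact mul_le_mul_of_nonneg_right (hg1 x) (sq_nonneg _)
  have l1 : Tendsto (fun δ : ℝ => (1 - 2 * δ) * ∫ x, V x * φ x ^ 2) (𝓝[>] 0)
      (𝓝 (∫ x, V x * φ x ^ 2)) := by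
    have : Continuous fun δ : ℝ => (1 - 2 * δ) * ∫ x, V x * φ x ^ 2 := by fun_prop
    simpa using (this.tendsto 0).mono_left nhdsWithin_le_nhds
  have l2 : Tendsto (fun δ : ℝ => δ * (∫ x, φ x ^ 2) + ∫ x, gdot φ φ x) (𝓝[>] 0)
      (𝓝 (∫ x, gdot φ φ x)) := by
    have : Continuous fun δ : ℝ => δ * (∫ x, φ x ^ 2) + ∫ x, gdot φ φ x := by fun_prop
    simpa using (this.tendsto 0).mono_left nhdsWithin_le_nhds
  exact le_of_tendsto_of_tendsto l1 l2 (eventually_of_mem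
    (Ioo_mem_nhdsGT (by norm_num : (0 : ℝ) < 1 / 2)) key)

end SchwartzExtension

section Mollification

open scoped Topology Convolution
open Filter

variable {N : ℕ}

theorem abs_normed_convolution_le (b : ContDiffBump (0 : EuclideanSpace ℝ (Fin N)))
    {h : EuclideanSpace ℝ (Fin N) → ℝ} (hc : Continuous h) {r M : ℝ}
    (hr : tsupport h ⊆ Metric.closedBall 0 r) (hM : ∀ x, |h x| ≤ M) (hb : b.rOut ≤ 1)
    (x : EuclideanSpace ℝ (Fin N)) :
    |(b.normed volume ⋆[ContinuousLinearMap.lsmul ℝ ℝ, volume] h) x| ≤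
      (Metric.closedBall (0 : EuclideanSpace ℝ (Fin N)) (r + 1)).indicator (fun _ => 3 * M) x := by
  by_cases hx : x ∈ Metric.closedBall (0 : EuclideanSpace ℝ (Fin N)) (r + 1)
  · rw [Set.indicator_of_mem hx]
    have h1 := b.dist_normed_convolution_le (μ := volume) (x₀ := x) (ε := 2 * M)
      hc.aestronglyMeasurable (fun y _ => by
        rw [Real.dist_eq]
        exact (abs_sub _ _).trans (by linarith [hM x, hM y]))
    rw [Real.dist_eq] at h1
    have h2 := abs_sub_abs_le_abs_sub
      ((b.normed volume ⋆[ContinuousLinearMap.lsmul ℝ ℝ, volume] h) x) (h x)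
    linarith [hM x]
  · rw [Set.indicator_of_notMem hx]
    have h0 : ∀ y, dist y x < 1 → h y = 0 := fun y hy => by
      refine image_eq_zero_of_notMem_tsupport fun hy' => hx ?_
      have := hr hy'
      rw [Metric.mem_closedBall] at this ⊢
      linarith [dist_triangle x y 0, dist_comm x y]
    have h1 := b.dist_normed_convolution_le (μ := volume) (x₀ := x) (ε := 0)
      hc.aestronglyMeasurable (fun y hy => by
        rw [h0 y (lt_of_lt_of_le hy hb), h0 x (by simp), dist_self])
    rw [h0 x (by simp), Real.dist_eq, sub_zero] at h1
    exact h1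

theorem tendsto_integral_mul_normed_convolution_sq
    {b : ℕ → ContDiffBump (0 : EuclideanSpace ℝ (Fin N))} (hb : ∀ n, (b n).rOut ≤ 1)
    (hb0 : Tendsto (fun n => (b n).rOut) atTop (𝓝 0)) {W h : EuclideanSpace ℝ (Fin N) → ℝ}
    (hW : Continuous W) (hc : Continuous h) (hs : HasCompactSupport h) :
    Tendsto (fun n => ∫ x, W x *
      ((b n).normed volume ⋆[ContinuousLinearMap.lsmul ℝ ℝ, volume] h) x ^ 2) atTop
      (𝓝 (∫ x, W x * h x ^ 2)) := by
  obtain ⟨M, hM⟩ := hc.bounded_above_of_compact_support hs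
  obtain ⟨r, hr⟩ := hs.isCompact.isBounded.subset_closedBall 0
  have hcont : ∀ n, Continuous
      ((b n).normed volume ⋆[ContinuousLinearMap.lsmul ℝ ℝ, volume] h) := fun n =>
    (b n).hasCompactSupport_normed.continuous_convolution_left _ (b n).continuous_normed
      hc.locallyIntegrable
  refine tendsto_integral_of_dominated_convergence
    ((Metric.closedBall (0 : EuclideanSpace ℝ (Fin N)) (r + 1)).indicator
      fun x => |W x| * (3 * M) ^ 2) (fun n => ?_) ?_ (fun n => ?_) ?_
  · exact (hW.mul ((hcont n).pow 2)).aestronglyMeasurable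
  · rw [integrable_indicator_iff Metric.isClosed_closedBall.measurableSet]
    exact (Continuous.continuousOn (by fun_prop)).integrableOn_compact
      (isCompact_closedBall _ _)
  · refine Eventually.of_forall fun x => ?_
    have h1 := abs_normed_convolution_le (b n) hc hr hM (hb n) x
    rw [Real.norm_eq_abs, abs_mul, abs_pow]
    by_cases hx : x ∈ Metric.closedBall (0 : EuclideanSpace ℝ (Fin N)) (r + 1)
    · rw [Set.indicator_of_mem hx] at h1 ⊢
      exact mul_le_mul_of_nonneg_left (pow_le_pow_left₀ (abs_nonneg _) h1 2) (abs_nonneg _)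
    · rw [Set.indicator_of_notMem hx] at h1 ⊢
      rw [le_antisymm h1 (abs_nonneg _)]
      simp
  · refine Eventually.of_forall fun x => ?_
    exact ((ContDiffBump.convolution_tendsto_right_of_continuous hb0 hc x).pow 2).const_mul (W x)

theorem pd_normed_convolution (b : ContDiffBump (0 : EuclideanSpace ℝ (Fin N)))
    {h : EuclideanSpace ℝ (Fin N) → ℝ} (hh : ContDiff ℝ 1 h) (hs : HasCompactSupport h)
    (i : Fin N) :
    pd i (b.normed volume ⋆[ContinuousLinearMap.lsmul ℝ ℝ, volume] h) =
      (b.normed volume ⋆[ContinuousLinearMap.lsmul ℝ ℝ, volume] pd i h) := by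
  ext x
  have hli : LocallyIntegrable (b.normed volume) volume := b.continuous_normed.locallyIntegrable
  rw [pd, (hs.hasFDerivAt_convolution_right _ hli hh x).fderiv,
    convolution_precompR_apply _ hli (hs.fderiv ℝ) (hh.continuous_fderiv one_ne_zero)]
  rfl

theorem integral_mul_sq_le_of_contDiff_one {V : EuclideanSpace ℝ (Fin N) → ℝ} (hVc : Continuous V)
    (hV : ∀ φ : EuclideanSpace ℝ (Fin N) → ℝ, ContDiff ℝ (⊤ : ℕ∞) φ → HasCompactSupport φ →
      ∫ x, V x * φ x ^ 2 ≤ ∫ x, gdot φ φ x)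
    {φ : EuclideanSpace ℝ (Fin N) → ℝ} (hφ : ContDiff ℝ 1 φ) (hφc : HasCompactSupport φ) :
    ∫ x, V x * φ x ^ 2 ≤ ∫ x, gdot φ φ x := by
  have hpos : ∀ n : ℕ, (0 : ℝ) < 1 / ((n : ℝ) + 1) := fun n => Nat.one_div_pos_of_nat
  let b : ℕ → ContDiffBump (0 : EuclideanSpace ℝ (Fin N)) := fun n =>
    ⟨1 / ((n : ℝ) + 1) / 2, 1 / ((n : ℝ) + 1), half_pos (hpos n), half_lt_self (hpos n)⟩
  have hb : ∀ n, (b n).rOut ≤ 1 := fun n =>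
    (div_le_one (by positivity)).2 (by linarith [(Nat.cast_nonneg n : (0 : ℝ) ≤ n)])
  have hb0 : Tendsto (fun n => (b n).rOut) atTop (𝓝 0) := tendsto_one_div_add_atTop_nhds_zero_nat
  set ψ := fun n => ((b n).normed volume ⋆[ContinuousLinearMap.lsmul ℝ ℝ, volume] φ) with hψ
  have hψs : ∀ n, ContDiff ℝ (⊤ : ℕ∞) (ψ n) := fun n =>
    (b n).hasCompactSupport_normed.contDiff_convolution_left _ (b n).contDiff_normed
      hφ.continuous.locallyIntegrable
  have hψc : ∀ n, HasCompactSupport (ψ n) := fun n =>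
    (b n).hasCompactSupport_normed.convolution _ hφc
  have hsum : ∀ {f : EuclideanSpace ℝ (Fin N) → ℝ}, ContDiff ℝ 1 f → HasCompactSupport f →
      ∫ x, gdot f f x = ∑ i, ∫ x, 1 * pd i f x ^ 2 := fun hf hfc => by
    simp only [gdot, one_mul, pow_two]
    exact integral_finsetSum _ fun i _ => ((continuous_pd hf i).mul
      (continuous_pd hf i)).integrable_of_hasCompactSupport (hasCompactSupport_pd hfc i).mul_right
  have l1 := tendsto_integral_mul_normed_convolution_sq hb hb0 hVc hφ.continuous hφc
  have l2 : Tendsto (fun n => ∫ x, gdot (ψ n) (ψ n) x) atTop (𝓝 (∫ x, gdot φ φ x)) := by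
    rw [hsum hφ hφc]
    simp only [hsum ((hψs _).of_le (by simp)) (hψc _)]
    refine tendsto_finsetSum _ fun i _ => ?_
    simp only [hψ, pd_normed_convolution _ hφ hφc]
    exact tendsto_integral_mul_normed_convolution_sq hb hb0 continuous_const (continuous_pd hφ i)
      (hasCompactSupport_pd hφc i)
  exact le_of_tendsto_of_tendsto' l1 l2 fun n => hV _ (hψs n) (hψc n)

end Mollification

section MainEstimate

variable {N : ℕ}

theorem gdot_mul_self {f η : EuclideanSpace ℝ (Fin N) → ℝ} (hf : Differentiable ℝ f)
    (hη : Differentiable ℝ η) (x : EuclideanSpace ℝ (Fin N)) :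
    gdot (fun y => f y * η y) (fun y => f y * η y) x =
      η x ^ 2 * gdot f f x + 2 * f x * η x * gdot f η x + f x ^ 2 * gdot η η x := by
  simp only [gdot, pd_mul (hf x) (hη x), Finset.mul_sum, ← Finset.sum_add_distrib]
  exact Finset.sum_congr rfl fun i _ => by ring

theorem gdot_rpow {f g : EuclideanSpace ℝ (Fin N) → ℝ} (a : ℝ) (hf : Differentiable ℝ f)
    (h0 : ∀ x, 0 < f x) (x : EuclideanSpace ℝ (Fin N)) :
    gdot (fun y => f y ^ a) g x = a * f x ^ (a - 1) * gdot f g x := by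
  simp only [gdot, pd_rpow a (hf x) (h0 x).ne', Finset.mul_sum]
  exact Finset.sum_congr rfl fun i _ => by ring

theorem gdot_sq {f g : EuclideanSpace ℝ (Fin N) → ℝ} (hg : Differentiable ℝ g)
    (x : EuclideanSpace ℝ (Fin N)) :
    gdot f (fun y => g y ^ 2) x = 2 * g x * gdot f g x := by
  simp only [gdot, pd_pow 2 (hg x), Finset.mul_sum]
  exact Finset.sum_congr rfl fun i _ => by norm_num; ring

theorem integral_gdot_rpow_mul_le {w η : EuclideanSpace ℝ (Fin N) → ℝ} (hw : ContDiff ℝ 2 w)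
    (hw0 : ∀ x, 0 < w x) {τ : ℝ} (hτ : 2 ≤ τ) (hη : ContDiff ℝ 2 η) (hηc : HasCompactSupport η) :
    ∫ x, gdot (fun y => w y ^ (τ / 2) * η y) (fun y => w y ^ (τ / 2) * η y) x ≤
      τ ^ 2 / (4 * (τ - 1)) * (∫ x, -lap w x * w x ^ (τ - 1) * η x ^ 2) +
      ∫ x, w x ^ τ * (gdot η η x + |lap (fun y => η y ^ 2) x|) := by
  have hwd : Differentiable ℝ w := hw.differentiable (by norm_num)
  have hηd : Differentiable ℝ η := hη.differentiable (by norm_num)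
  have hrp : ∀ a : ℝ, ContDiff ℝ 2 fun y => w y ^ a := fun a =>
    hw.rpow_const_of_ne fun x => (hw0 x).ne'
  have hη2 : ContDiff ℝ 2 fun y => η y ^ 2 := hη.pow 2
  have hη2c : HasCompactSupport fun y => η y ^ 2 :=
    hηc.comp_left (g := fun y : ℝ => y ^ 2) (by simp)
  have hτ1 : 0 < τ - 1 := by linarith
  have hpt : ∀ x, gdot (fun y => w y ^ (τ / 2) * η y) (fun y => w y ^ (τ / 2) * η y) x =
      τ ^ 2 / (4 * (τ - 1)) * (-lap w x * w x ^ (τ - 1) * η x ^ 2) +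
      (τ / (4 * (τ - 1)) * (η x ^ 2 * lap (fun y => w y ^ τ) x) +
      (1 / 2 * gdot (fun y => w y ^ τ) (fun y => η y ^ 2) x + w x ^ τ * gdot η η x)) := fun x => by
    rw [gdot_mul_self ((hrp _).differentiable (by norm_num)) hηd,
      gdot_rpow _ hwd hw0, gdot_comm w, gdot_rpow _ hwd hw0, gdot_rpow _ hwd hw0, gdot_sq hηd,
      gdot_rpow _ hwd hw0, lap_rpow _ hw hw0]
    have e1 : w x ^ (τ / 2 - 1) * w x ^ (τ / 2 - 1) = w x ^ (τ - 2) := by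
      rw [← rpow_add (hw0 x)]; ring_nf
    have e2 : w x ^ (τ / 2) * w x ^ (τ / 2 - 1) = w x ^ (τ - 1) := by
      rw [← rpow_add (hw0 x)]; ring_nf
    have e3 : (w x ^ (τ / 2)) ^ 2 = w x ^ τ := by
      rw [pow_two, ← rpow_add (hw0 x)]; ring_nf
    have : η x ^ 2 * (τ / 2 * w x ^ (τ / 2 - 1) * (τ / 2 * w x ^ (τ / 2 - 1) * gdot w w x)) +
        2 * w x ^ (τ / 2) * η x * (τ / 2 * w x ^ (τ / 2 - 1) * gdot w η x) +
        (w x ^ (τ / 2)) ^ 2 * gdot η η x =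
        τ ^ 2 / 4 * (w x ^ (τ / 2 - 1) * w x ^ (τ / 2 - 1)) * gdot w w x * η x ^ 2 +
        τ * (w x ^ (τ / 2) * w x ^ (τ / 2 - 1)) * η x * gdot w η x +
        (w x ^ (τ / 2)) ^ 2 * gdot η η x := by ring
    rw [this, e1, e2, e3]
    field_simp
    ring
  have hcw : ∀ a : ℝ, Continuous fun y => w y ^ a := fun a => (hrp a).continuous
  have i1 : Integrable fun x => -lap w x * w x ^ (τ - 1) * η x ^ 2 :=
    (((continuous_lap hw).neg.mul (hcw _)).mul hη2.continuous).integrable_of_hasCompactSupport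
      hη2c.mul_left
  have i2 : Integrable fun x => η x ^ 2 * lap (fun y => w y ^ τ) x :=
    (hη2.continuous.mul (continuous_lap (hrp τ))).integrable_of_hasCompactSupport hη2c.mul_right
  have i3 : Integrable fun x => gdot (fun y => w y ^ τ) (fun y => η y ^ 2) x := by
    simp only [fun x => gdot_comm (fun y => w y ^ τ) (fun y => η y ^ 2) x]
    exact (continuous_gdot (hη2.of_le (by norm_num)) ((hrp τ).of_le
      (by norm_num))).integrable_of_hasCompactSupport (hasCompactSupport_gdot hη2c)
  have i4 : Integrable fun x => w x ^ τ * gdot η η x :=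
    ((hcw τ).mul (continuous_gdot (hη.of_le (by norm_num)) (hη.of_le
      (by norm_num)))).integrable_of_hasCompactSupport (hasCompactSupport_gdot hηc).mul_left
  have i5 : Integrable fun x => w x ^ τ * lap (fun y => η y ^ 2) x :=
    ((hcw τ).mul (continuous_lap hη2)).integrable_of_hasCompactSupport
      (hasCompactSupport_lap hη2c).mul_left
  have i6 : Integrable fun x => w x ^ τ * |lap (fun y => η y ^ 2) x| :=
    ((hcw τ).mul (continuous_lap hη2).abs).integrable_of_hasCompactSupport
      ((hasCompactSupport_lap hη2c).abs).mul_left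
  have i34 : Integrable fun x => 1 / 2 * gdot (fun y => w y ^ τ) (fun y => η y ^ 2) x +
    w x ^ τ * gdot η η x := (i3.const_mul _).add i4
  have i234 : Integrable fun x => τ / (4 * (τ - 1)) * (η x ^ 2 * lap (fun y => w y ^ τ) x) +
    (1 / 2 * gdot (fun y => w y ^ τ) (fun y => η y ^ 2) x + w x ^ τ * gdot η η x) :=
    (i2.const_mul _).add i34
  simp only [hpt]
  rw [integral_add (i1.const_mul _) i234, integral_add (i2.const_mul _) i34,
    integral_add (i3.const_mul _) i4, integral_const_mul, integral_const_mul, integral_const_mul,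
    integral_gdot' ((hrp τ).of_le (by norm_num)) hη2 hη2c, ← integral_mul_lap_comm (hrp τ) hη2 hη2c]
  have hsplit : ∫ x, w x ^ τ * (gdot η η x + |lap (fun y => η y ^ 2) x|) =
      (∫ x, w x ^ τ * gdot η η x) + ∫ x, w x ^ τ * |lap (fun y => η y ^ 2) x| := by
    simp only [mul_add]
    exact integral_add i4 i6
  have habs : |∫ x, w x ^ τ * lap (fun y => η y ^ 2) x| ≤
      ∫ x, w x ^ τ * |lap (fun y => η y ^ 2) x| := by
    refine (abs_integral_le_integral_abs).trans_eq (integral_congr_ae (.of_forall fun x => ?_))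
    dsimp only
    rw [abs_mul, abs_of_pos (rpow_pos_of_pos (hw0 x) τ)]
  have hk1 : τ / (4 * (τ - 1)) ≤ 1 / 2 := by
    rw [div_le_iff₀ (by linarith)]; linarith
  have hk0 : 0 ≤ τ / (4 * (τ - 1)) := by positivity
  rw [hsplit]
  obtain ⟨h1, h2⟩ := abs_le.1 habs
  nlinarith

/-- The Young-type bound `X^{s-1} Y + X Y^{s-1} ≤ X^s + Y^s`. -/
theorem rpow_sub_one_mul_add_le {X Y s : ℝ} (hX : 0 < X) (hY : 0 < Y) (hs : 2 ≤ s) :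
    X ^ (s - 1) * Y + X * Y ^ (s - 1) ≤ X ^ s + Y ^ s := by
  have e1 : ∀ {Z : ℝ}, 0 < Z → Z ^ s = Z ^ (s - 1) * Z := fun hZ => by
    rw [← rpow_add_one hZ.ne']; ring_nf
  rw [e1 hX, e1 hY]
  have hs1 : 0 ≤ s - 1 := by linarith
  rcases le_total X Y with h | h
  · have := rpow_le_rpow hX.le h hs1
    nlinarith
  · have := rpow_le_rpow hY.le h hs1
    nlinarith

theorem add_le_of_coupled_le {κ A B a b c d e₁ e₂ s : ℝ} (hκ : 0 < κ) (hA : 0 < A) (hB : 0 < B)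
    (hAB : A * B < κ ^ 2) (h1 : κ * a ≤ A * c + e₁) (h2 : κ * b ≤ B * d + e₂)
    (h3 : ∀ t : ℝ, 0 < t → t ^ (s - 1) * c + t * d ≤ t ^ s * a + b) (hc : 0 ≤ c) :
    d ≤ (√(B / A))⁻¹ * ((√(B / A)) ^ s * e₁ + e₂) / (κ - √(A * B)) := by
  set t := √(B / A) with ht
  have ht0 : 0 < t := sqrt_pos.2 (by positivity)
  set θ := √(A * B) with hθ
  have hθκ : θ < κ := (sqrt_lt' hκ).2 hAB
  have hAt : A * t = θ := by
    rw [ht, hθ, ← sqrt_sq hA.le, ← sqrt_mul (by positivity), sqrt_sq hA.le]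
    congr 1; field_simp
  have hBt : B = θ * t := by
    rw [← hAt, mul_assoc, ht, mul_self_sqrt (by positivity)]; field_simp
  have h4 := h3 t ht0
  have hts : t ^ s = t ^ (s - 1) * t := by
    rw [← rpow_add_one ht0.ne']; ring_nf
  have hts0 : 0 < t ^ (s - 1) := rpow_pos_of_pos ht0 _
  have h5 : t ^ s * (κ * a) ≤ t ^ s * (A * c + e₁) :=
    mul_le_mul_of_nonneg_left h1 (rpow_pos_of_pos ht0 _).le
  have hθ0 : 0 ≤ θ := sqrt_nonneg _
  have h6 : κ * (t ^ s * a + b) ≤ θ * (t ^ s * a + b) + (t ^ s * e₁ + e₂) := by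
    have h7 := mul_le_mul_of_nonneg_left h4 hθ0
    have h8 : t ^ s * (A * c) = θ * (t ^ (s - 1) * c) := by rw [hts, ← hAt]; ring
    have h9 : B * d = θ * (t * d) := by rw [hBt]; ring
    nlinarith
  have h10 : t * d ≤ t ^ s * a + b := by nlinarith
  rw [le_div_iff₀ (by linarith), inv_mul_eq_div, le_div_iff₀ ht0]
  nlinarith

theorem exists_integral_gdot_rpow_mul_le {p s : ℝ} (hp : 1 < p) (hs : 2 ≤ s)
    (hL : Lpoly p s < 0) {u v : EuclideanSpace ℝ (Fin N) → ℝ} (hu : ContDiff ℝ 2 u)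
    (hv : ContDiff ℝ 2 v) (hu0 : ∀ x, 0 < u x) (hv0 : ∀ x, 0 < v x)
    (huv : ∀ x, -lap u x = v x) (hvu : ∀ x, -lap v x = u x ^ p)
    (hle : ∀ x, √(2 / (p + 1)) * u x ^ ((p + 1) / 2) ≤ v x)
    (hst : ∀ φ : EuclideanSpace ℝ (Fin N) → ℝ, ContDiff ℝ 1 φ → HasCompactSupport φ →
      ∫ x, √p * u x ^ ((p - 1) / 2) * φ x ^ 2 ≤ ∫ x, gdot φ φ x) :
    ∃ C : ℝ, 0 < C ∧ ∀ η : EuclideanSpace ℝ (Fin N) → ℝ, ContDiff ℝ 2 η → HasCompactSupport η →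
      ∫ x, gdot (fun y => v y ^ (s / 2) * η y) (fun y => v y ^ (s / 2) * η y) x ≤
        C * ∫ x, v x ^ s * (gdot η η x + |lap (fun y => η y ^ 2) x|) := by
  set σ : ℝ := (p + 1) / 2 with hσ
  have hσ1 : 1 < σ := by rw [hσ]; linarith
  have hpσ : p = 2 * σ - 1 := by rw [hσ]; ring
  have hσs : 2 ≤ σ * s := by nlinarith
  set A : ℝ := (σ * s) ^ 2 / (4 * (σ * s - 1)) with hA
  set B : ℝ := s ^ 2 / (4 * (s - 1)) with hB
  have hs1 : 0 < s - 1 := by linarith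
  have hσs1 : 0 < σ * s - 1 := by linarith
  have hA0 : 0 < A := by positivity
  have hB0 : 0 < B := by positivity
  have hAB : A * B < √p ^ 2 := by
    rw [sq_sqrt (by linarith), hA, hB, div_mul_div_comm, div_lt_iff₀ (by positivity)]
    have : Lpoly p s = s ^ 4 - 16 * p / σ ^ 2 * ((s - 1) * (σ * s - 1)) := by
      rw [Lpoly, hσ]; field_simp; ring
    rw [this, sub_neg, div_mul_eq_mul_div, lt_div_iff₀ (by positivity)] at hL
    nlinarith
  have hsp : 0 < √p := sqrt_pos.2 (by linarith)
  have hcu : ∀ a : ℝ, Continuous fun y => u y ^ a := fun a =>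
    (hu.rpow_const_of_ne fun x => (hu0 x).ne').continuous
  have hcv : ∀ a : ℝ, Continuous fun y => v y ^ a := fun a =>
    (hv.rpow_const_of_ne fun x => (hv0 x).ne').continuous
  set c₀ : ℝ := (√(2 / (p + 1)))⁻¹ ^ s with hc₀
  have hl0 : 0 < √(2 / (p + 1)) := sqrt_pos.2 (by positivity)
  have hc₀0 : 0 < c₀ := by positivity
  have huvs : ∀ x, u x ^ (σ * s) ≤ c₀ * v x ^ s := fun x => by
    rw [rpow_mul (hu0 x).le, hc₀, ← mul_rpow (by positivity) (hv0 x).le]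
    refine rpow_le_rpow (rpow_pos_of_pos (hu0 x) _).le ?_ (by linarith)
    rw [inv_mul_eq_div, le_div_iff₀ hl0, mul_comm]
    exact hle x
  set t := √(B / A) with ht
  have ht0 : 0 < t := sqrt_pos.2 (by positivity)
  have hθ : 0 < √p - √(A * B) := sub_pos.2 ((sqrt_lt' hsp).2 hAB)
  refine ⟨B * (t⁻¹ * (t ^ s * c₀ + 1) / (√p - √(A * B))) + 1, by positivity,
    fun η hη hηc => ?_⟩
  have hη2 : ContDiff ℝ 2 fun y => η y ^ 2 := hη.pow 2
  have hη2c : HasCompactSupport fun y => η y ^ 2 :=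
    hηc.comp_left (g := fun y : ℝ => y ^ 2) (by simp)
  set E := ∫ x, v x ^ s * (gdot η η x + |lap (fun y => η y ^ 2) x|) with hE
  set e : EuclideanSpace ℝ (Fin N) → ℝ := fun x => gdot η η x + |lap (fun y => η y ^ 2) x| with he
  have hec : Continuous e := (continuous_gdot (hη.of_le (by norm_num)) (hη.of_le
    (by norm_num))).add (continuous_lap hη2).abs
  have hes : HasCompactSupport e :=
    (hasCompactSupport_gdot hηc).add (hasCompactSupport_lap hη2c).abs
  have he0 : ∀ x, 0 ≤ e x := fun x => add_nonneg (gdot_self_nonneg _ _) (abs_nonneg _)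
  have hEu : ∫ x, u x ^ (σ * s) * e x ≤ c₀ * E := by
    rw [hE, ← integral_const_mul]
    refine integral_mono (((hcu _).mul hec).integrable_of_hasCompactSupport hes.mul_left)
      ((((hcv _).mul hec).integrable_of_hasCompactSupport hes.mul_left).const_mul _) fun x => ?_
    dsimp only
    rw [← mul_assoc]
    exact mul_le_mul_of_nonneg_right (huvs x) (he0 x)
  have hInt : ∀ {f : EuclideanSpace ℝ (Fin N) → ℝ}, Continuous f →
      Integrable fun x => f x * η x ^ 2 := fun hf =>
    (hf.mul hη2.continuous).integrable_of_hasCompactSupport hη2c.mul_left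
  have hsq : ∀ {f : EuclideanSpace ℝ (Fin N) → ℝ} {τ : ℝ}, (∀ x, 0 < f x) → ∀ x,
      √p * u x ^ ((p - 1) / 2) * (f x ^ (τ / 2) * η x) ^ 2 =
      √p * (u x ^ (σ - 1) * f x ^ τ * η x ^ 2) := fun hf x => by
    rw [mul_pow, ← rpow_natCast, ← rpow_mul (hf x).le, show (p - 1) / 2 = σ - 1 by rw [hσ]; ring]
    push_cast
    rw [div_mul_cancel₀ _ two_ne_zero]
    ring
  have hφ : ∀ {f : EuclideanSpace ℝ (Fin N) → ℝ} (τ : ℝ), ContDiff ℝ 2 f → (∀ x, 0 < f x) →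
      ContDiff ℝ 1 fun y => f y ^ τ * η y := fun τ hf hf0 =>
    ((hf.rpow_const_of_ne fun x => (hf0 x).ne').mul hη).of_le (by norm_num)
  have g1 := integral_gdot_rpow_mul_le hu hu0 hσs hη hηc
  have g2 := integral_gdot_rpow_mul_le hv hv0 hs hη hηc
  have k1 := hst _ (hφ (σ * s / 2) hu hu0) hηc.mul_left
  have k2 := hst _ (hφ (s / 2) hv hv0) hηc.mul_left
  simp only [hsq hu0, hsq hv0, integral_const_mul] at k1 k2
  simp only [huv, hvu] at g1 g2
  have e1 : ∀ x, v x * u x ^ (σ * s - 1) = u x ^ (σ - 1) * ((u x ^ σ) ^ (s - 1) * v x) :=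
      fun x => by
    rw [← rpow_mul (hu0 x).le, ← mul_assoc, ← rpow_add (hu0 x), mul_comm]
    ring_nf
  have e2 : ∀ x, u x ^ p * v x ^ (s - 1) = u x ^ (σ - 1) * (u x ^ σ * v x ^ (s - 1)) := fun x => by
    rw [← mul_assoc, ← rpow_add (hu0 x), hpσ]
    ring_nf
  simp only [e1] at g1
  simp only [e2] at g2
  simp only [rpow_mul (hu0 _).le σ s] at k1
  have hXc : Continuous fun x => u x ^ σ := hcu σ
  have hXa : ∀ a : ℝ, Continuous fun x => (u x ^ σ) ^ a := fun a => by
    simpa only [← rpow_mul (hu0 _).le] using hcu (σ * a)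
  have hω := hcu (σ - 1)
  have hX0 : ∀ x, 0 < u x ^ σ := fun x => rpow_pos_of_pos (hu0 x) _
  have ia := hInt (hω.mul (hXa s))
  have ib := hInt (hω.mul (hcv s))
  have ic := hInt (hω.mul ((hXa (s - 1)).mul hv.continuous))
  have id := hInt (hω.mul (hXc.mul (hcv (s - 1))))
  simp only [Pi.mul_apply] at ia ib ic id
  have h3 : ∀ t : ℝ, 0 < t →
      t ^ (s - 1) * (∫ x, u x ^ (σ - 1) * ((u x ^ σ) ^ (s - 1) * v x) * η x ^ 2) +
      t * (∫ x, u x ^ (σ - 1) * (u x ^ σ * v x ^ (s - 1)) * η x ^ 2) ≤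
      t ^ s * (∫ x, u x ^ (σ - 1) * (u x ^ σ) ^ s * η x ^ 2) +
      ∫ x, u x ^ (σ - 1) * v x ^ s * η x ^ 2 := fun t ht => by
    rw [← integral_const_mul, ← integral_const_mul, ← integral_const_mul,
      ← integral_add (ic.const_mul _) (id.const_mul _), ← integral_add (ia.const_mul _) ib]
    refine integral_mono ((ic.const_mul _).add (id.const_mul _)) ((ia.const_mul _).add ib)
      fun x => ?_
    have hy := rpow_sub_one_mul_add_le (mul_pos ht (hX0 x)) (hv0 x) hs
    rw [mul_rpow ht.le (hX0 x).le, mul_rpow ht.le (hX0 x).le] at hy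
    have hw : 0 ≤ u x ^ (σ - 1) * η x ^ 2 :=
      mul_nonneg (rpow_pos_of_pos (hu0 x) _).le (sq_nonneg _)
    have := mul_le_mul_of_nonneg_left hy hw
    dsimp only
    linarith
  have hc : 0 ≤ ∫ x, u x ^ (σ - 1) * ((u x ^ σ) ^ (s - 1) * v x) * η x ^ 2 :=
    integral_nonneg fun x => mul_nonneg (mul_nonneg (rpow_pos_of_pos (hu0 x) _).le
      (mul_nonneg (rpow_pos_of_pos (hX0 x) _).le (hv0 x).le)) (sq_nonneg _)
  have hd := add_le_of_coupled_le hsp hA0 hB0 hAB (k1.trans (g1.trans (add_le_add_right hEu _)))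
    (k2.trans g2) h3 hc
  have := mul_le_mul_of_nonneg_left hd hB0.le
  refine g2.trans ((add_le_add_left this _).trans (le_of_eq ?_))
  rw [← hE]
  ring

end MainEstimate

section SobolevStep

variable {N : ℕ}

theorem norm_fderiv_sq_le_gdot (f : EuclideanSpace ℝ (Fin N) → ℝ) (x : EuclideanSpace ℝ (Fin N)) :
    ‖fderiv ℝ f x‖ ^ 2 ≤ gdot f f x := by
  have h0 := gdot_self_nonneg f x
  have h : ‖fderiv ℝ f x‖ ≤ √(gdot f f x) := by
    refine ContinuousLinearMap.opNorm_le_bound _ (sqrt_nonneg _) fun v => ?_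
    have hv : fderiv ℝ f x v = ∑ i, v i * pd i f x := by
      conv_lhs => rw [← (EuclideanSpace.basisFun (Fin N) ℝ).sum_repr v]
      simp [pd]
    rw [← abs_of_nonneg (norm_nonneg v), ← sqrt_sq_eq_abs, ← sqrt_mul h0, hv, Real.norm_eq_abs,
      ← sqrt_sq_eq_abs]
    refine sqrt_le_sqrt ((Finset.sum_mul_sq_le_sq_mul_sq _ _ _).trans_eq ?_)
    rw [EuclideanSpace.real_norm_sq_eq, mul_comm]
    simp only [gdot, pow_two]
  calc ‖fderiv ℝ f x‖ ^ 2 ≤ √(gdot f f x) ^ 2 := pow_le_pow_left₀ (norm_nonneg _) h 2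
    _ = gdot f f x := sq_sqrt h0

theorem integral_norm_fderiv_sq_le {φ : EuclideanSpace ℝ (Fin N) → ℝ} (hφ : ContDiff ℝ 1 φ)
    (hφc : HasCompactSupport φ) : ∫ x, ‖fderiv ℝ φ x‖ ^ 2 ≤ ∫ x, gdot φ φ x := by
  have hfc : Continuous (fderiv ℝ φ) := hφ.continuous_fderiv one_ne_zero
  have h1 : Continuous fun x => ‖fderiv ℝ φ x‖ ^ 2 := hfc.norm.pow 2
  have h2 : HasCompactSupport fun x => ‖fderiv ℝ φ x‖ ^ 2 :=
    (hφc.fderiv ℝ).comp_left (g := fun y => ‖y‖ ^ 2) (by simp)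
  exact integral_mono (h1.integrable_of_hasCompactSupport h2)
    ((continuous_gdot hφ hφ).integrable_of_hasCompactSupport (hasCompactSupport_gdot hφc))
    (norm_fderiv_sq_le_gdot φ)

theorem exists_sobolev_const (hN : 2 < N) : ∃ C : ℝ, 0 < C ∧
    ∀ φ : EuclideanSpace ℝ (Fin N) → ℝ, ContDiff ℝ 1 φ → HasCompactSupport φ →
      (∫ x, |φ x| ^ (2 * ((N : ℝ) / (N - 2)))) ^ (((N : ℝ) / (N - 2))⁻¹) ≤
        C * ∫ x, gdot φ φ x := by
  have hN' : (2 : ℝ) < N := by exact_mod_cast hN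
  set κ : ℝ := (N : ℝ) / (N - 2) with hκ
  have hκ0 : 0 < κ := div_pos (by linarith) (by linarith)
  set q : NNReal := ⟨2 * κ, by positivity⟩ with hq
  have hqr : (q : ℝ) = 2 * κ := rfl
  have hq0 : (q : ENNReal) ≠ 0 := by
    simp only [ne_eq, ENNReal.coe_eq_zero, ← NNReal.coe_eq_zero, hqr]; positivity
  set K := eLpNormLESNormFDerivOfEqInnerConst (volume : Measure (EuclideanSpace ℝ (Fin N)))
    ((2 : NNReal) : ℝ) with hK
  refine ⟨(K : ℝ) ^ 2 + 1, by positivity, fun φ hφ hφc => ?_⟩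
  have h : eLpNorm φ q volume ≤ K * eLpNorm (fderiv ℝ φ) ((2 : NNReal) : ENNReal) volume :=
    eLpNorm_le_eLpNorm_fderiv_of_eq_inner (volume : Measure (EuclideanSpace ℝ (Fin N)))
    hφ hφc (p := 2) (p' := q) one_le_two (by rw [finrank_euclideanSpace_fin]; omega) (by
      rw [finrank_euclideanSpace_fin, hqr, hκ]
      have : (N : ℝ) - 2 ≠ 0 := by linarith
      push_cast
      field_simp)
  have hfc : Continuous (fderiv ℝ φ) := hφ.continuous_fderiv one_ne_zero
  have hm1 : MemLp φ q volume := hφ.continuous.memLp_of_hasCompactSupport hφc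
  have hm2 : MemLp (fderiv ℝ φ) ((2 : NNReal) : ENNReal) volume :=
    hfc.memLp_of_hasCompactSupport (hφc.fderiv ℝ)
  rw [hm1.eLpNorm_eq_integral_rpow_norm hq0 ENNReal.coe_ne_top,
    hm2.eLpNorm_eq_integral_rpow_norm (by simp) ENNReal.coe_ne_top,
    ← ENNReal.ofReal_coe_nnreal (p := K), ← ENNReal.ofReal_mul (by positivity),
    ENNReal.ofReal_le_ofReal_iff (by positivity)] at h
  simp only [ENNReal.coe_toReal, hqr, Real.norm_eq_abs, NNReal.coe_ofNat, rpow_ofNat] at h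
  have hi0 : 0 ≤ ∫ x, |φ x| ^ (2 * κ) := integral_nonneg fun x => by positivity
  have hj0 : 0 ≤ ∫ x, ‖fderiv ℝ φ x‖ ^ 2 := integral_nonneg fun x => by positivity
  have h2 := pow_le_pow_left₀ (by positivity) h 2
  have e1 : ((∫ x, |φ x| ^ (2 * κ)) ^ (2 * κ)⁻¹) ^ 2 = (∫ x, |φ x| ^ (2 * κ)) ^ κ⁻¹ := by
    rw [← rpow_natCast, ← rpow_mul hi0]
    congr 1; push_cast; field_simp
  have e2 : ((∫ x, ‖fderiv ℝ φ x‖ ^ 2) ^ (2 : ℝ)⁻¹) ^ 2 = ∫ x, ‖fderiv ℝ φ x‖ ^ 2 := by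
    rw [← rpow_natCast, ← rpow_mul hj0]
    norm_num
  rw [e1, mul_pow, e2] at h2
  have h3 := integral_norm_fderiv_sq_le hφ hφc
  refine h2.trans (mul_le_mul (by linarith) h3 hj0 (by positivity))

theorem exists_ball_rpow_le (hN : 2 < N) {v : EuclideanSpace ℝ (Fin N) → ℝ} (hv : ContDiff ℝ 2 v)
    (hv0 : ∀ x, 0 < v x) {s C₁ : ℝ} (hC₁ : 0 < C₁)
    (hE : ∀ η : EuclideanSpace ℝ (Fin N) → ℝ, ContDiff ℝ 2 η → HasCompactSupport η →
      ∫ x, gdot (fun y => v y ^ (s / 2) * η y) (fun y => v y ^ (s / 2) * η y) x ≤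
        C₁ * ∫ x, v x ^ s * (gdot η η x + |lap (fun y => η y ^ 2) x|)) :
    ∃ C : ℝ, 0 < C ∧ ∀ R : ℝ, 0 < R →
      (∫ x in Metric.ball (0 : EuclideanSpace ℝ (Fin N)) R,
        v x ^ ((N : ℝ) / (N - 2) * s)) ^ (((N : ℝ) / (N - 2))⁻¹) ≤
      C * R ^ (-2 : ℝ) * ∫ x in Metric.ball (0 : EuclideanSpace ℝ (Fin N)) (2 * R), v x ^ s := by
  have hN' : (2 : ℝ) < N := by exact_mod_cast hN
  obtain ⟨S, hS0, hS⟩ := exists_sobolev_const hN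
  set κ : ℝ := (N : ℝ) / (N - 2) with hκ
  have hκ0 : 0 < κ := div_pos (by linarith) (by linarith)
  have hcv : ∀ a : ℝ, Continuous fun y => v y ^ a := fun a =>
    (hv.rpow_const_of_ne fun x => (hv0 x).ne').continuous
  have hib : ∀ a r : ℝ, IntegrableOn (fun y => v y ^ a)
      (Metric.ball (0 : EuclideanSpace ℝ (Fin N)) r) := fun a r =>
    ((hcv a).continuousOn.integrableOn_compact (isCompact_closedBall 0 r)).mono_set
      Metric.ball_subset_closedBall
  let b : ContDiffBump (0 : EuclideanSpace ℝ (Fin N)) := ⟨1, 3 / 2, one_pos, by norm_num⟩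
  have hb : ContDiff ℝ 2 b := b.contDiff
  have hb2 : ContDiff ℝ 2 fun x => b x ^ 2 := hb.pow 2
  set e : EuclideanSpace ℝ (Fin N) → ℝ := fun x => gdot b b x + |lap (fun y => b y ^ 2) x| with he
  have hec : Continuous e := (continuous_gdot (hb.of_le (by norm_num)) (hb.of_le
    (by norm_num))).add (continuous_lap hb2).abs
  have hb2c : HasCompactSupport fun y => b y ^ 2 :=
    b.hasCompactSupport.comp_left (g := fun y : ℝ => y ^ 2) (by simp)
  have hes : HasCompactSupport e :=
    (hasCompactSupport_gdot b.hasCompactSupport).add (hasCompactSupport_lap hb2c).abs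
  obtain ⟨K, hK⟩ := hec.bounded_above_of_compact_support hes
  have hK0 : 0 ≤ K := (norm_nonneg _).trans (hK 0)
  have he_out : ∀ x, 2 ≤ ‖x‖ → e x = 0 := fun x hx => by
    have hx1 : x ∉ tsupport b := by
      rw [b.tsupport_eq, mem_closedBall_zero_iff]
      change ¬ ‖x‖ ≤ 3 / 2
      linarith
    have hx2 : x ∉ tsupport fun y => b y ^ 2 := fun h => hx1 <|
      closure_mono (fun y hy => by
        rw [Function.mem_support] at hy ⊢
        exact fun h => hy (by rw [h]; simp)) h
    rw [he]
    simp only [gdot_eq_zero_of_notMem_tsupport hx1, lap_eq_zero_of_notMem_tsupport hx2, abs_zero,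
      add_zero]
  refine ⟨S * (C₁ * (K + 1)), by positivity, fun R hR => ?_⟩
  set η : EuclideanSpace ℝ (Fin N) → ℝ := fun x => b (R⁻¹ • x) with hη
  have hηs : ContDiff ℝ 2 η := hb.comp (contDiff_const_smul R⁻¹)
  have hηc : HasCompactSupport η := b.hasCompactSupport.comp_smul (inv_ne_zero hR.ne')
  have hηe : ∀ x, gdot η η x + |lap (fun y => η y ^ 2) x| = R ^ (-2 : ℝ) * e (R⁻¹ • x) :=
      fun x => by
    have h1 := fun i => pd_comp_affine (hb.differentiable (by norm_num)) 0 R⁻¹ i x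
    have h2 := lap_comp_affine hb2 0 R⁻¹ x
    simp only [zero_add] at h1 h2
    have hR2 : R ^ (-2 : ℝ) = R⁻¹ ^ 2 := by
      rw [rpow_neg hR.le, inv_pow]; norm_num
    simp only [gdot, he, hη, h1, h2]
    rw [hR2, abs_mul, abs_of_nonneg (sq_nonneg (R⁻¹)), mul_add, Finset.mul_sum]
    congr 1
    exact Finset.sum_congr rfl fun i _ => by ring
  have hφ : ContDiff ℝ 1 fun y => v y ^ (s / 2) * η y :=
    ((hv.rpow_const_of_ne fun x => (hv0 x).ne').mul hηs).of_le (by norm_num)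
  have hφc : HasCompactSupport fun y => v y ^ (s / 2) * η y := hηc.mul_left
  have h1 := (hS _ hφ hφc).trans (mul_le_mul_of_nonneg_left (hE η hηs hηc) hS0.le)
  have h2 : ∫ x in Metric.ball (0 : EuclideanSpace ℝ (Fin N)) R, v x ^ (κ * s) ≤
      ∫ x, |v x ^ (s / 2) * η x| ^ (2 * κ) := by
    have hInt : Integrable fun x => |v x ^ (s / 2) * η x| ^ (2 * κ) :=
      (hφ.continuous.abs.rpow_const fun x => Or.inr (by positivity)).integrable_of_hasCompactSupport
        (hφc.comp_left (g := fun y : ℝ => |y| ^ (2 * κ)) (by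
          simp only [abs_zero]; exact zero_rpow (by positivity)))
    refine le_trans (le_of_eq ?_) (setIntegral_le_integral (s := Metric.ball 0 R) hInt
      (.of_forall fun x => by positivity))
    refine setIntegral_congr_fun Metric.isOpen_ball.measurableSet fun x hx => ?_
    have hx1 : η x = 1 := b.one_of_mem_closedBall (by
      rw [mem_closedBall_zero_iff, norm_smul, norm_inv, Real.norm_of_nonneg hR.le]
      change R⁻¹ * ‖x‖ ≤ 1
      rw [inv_mul_eq_div, div_le_one hR]
      exact (mem_ball_zero_iff.1 hx).le)
    rw [hx1, mul_one, abs_of_pos (rpow_pos_of_pos (hv0 x) _), ← rpow_mul (hv0 x).le]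
    congr 1; ring
  have h3 : ∫ x, v x ^ s * (gdot η η x + |lap (fun y => η y ^ 2) x|) ≤
      (K + 1) * R ^ (-2 : ℝ) *
        ∫ x in Metric.ball (0 : EuclideanSpace ℝ (Fin N)) (2 * R), v x ^ s := by
    rw [← integral_const_mul]
    have hz : ∀ x, x ∉ Metric.ball (0 : EuclideanSpace ℝ (Fin N)) (2 * R) →
        v x ^ s * (gdot η η x + |lap (fun y => η y ^ 2) x|) = 0 := fun x hx => by
      rw [hηe, he_out, mul_zero, mul_zero]
      rw [mem_ball_zero_iff, not_lt] at hx
      rw [norm_smul, norm_inv, Real.norm_of_nonneg hR.le, inv_mul_eq_div, le_div_iff₀ hR]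
      exact hx
    rw [← setIntegral_eq_integral_of_forall_compl_eq_zero hz]
    have hcont : Continuous fun x => v x ^ s * (gdot η η x + |lap (fun y => η y ^ 2) x|) := by
      simp only [hηe]
      exact (hcv s).mul (continuous_const.mul (hec.comp (continuous_const_smul _)))
    refine setIntegral_mono ?_ ((hib s _).const_mul _) fun x => ?_
    · exact (hcont.continuousOn.integrableOn_compact (isCompact_closedBall 0 (2 * R))).mono_set
        Metric.ball_subset_closedBall
    · rw [hηe]
      have : e (R⁻¹ • x) ≤ K + 1 := ((le_abs_self _).trans (hK _)).trans (by linarith)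
      have hw : 0 ≤ v x ^ s * R ^ (-2 : ℝ) :=
        mul_nonneg (rpow_pos_of_pos (hv0 x) _).le (by positivity)
      have := mul_le_mul_of_nonneg_left this hw
      linarith
  have h4 := rpow_le_rpow (integral_nonneg fun x => (rpow_pos_of_pos (hv0 x) _).le) h2
    (inv_nonneg.2 hκ0.le)
  refine h4.trans (h1.trans ?_)
  have h5 := mul_le_mul_of_nonneg_left h3 (mul_pos hS0 hC₁).le
  linarith

end SobolevStep

section Polynomial

theorem one_lt_t0 {p : ℝ} (hp : 1 < p) : 1 < t0 p := by
  have h1 : 1 < 2 * p / (p + 1) := by rw [lt_div_iff₀ (by linarith)]; linarith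
  have h2 : 1 < √(2 * p / (p + 1)) := by
    rw [lt_sqrt zero_le_one]; simpa using h1
  have := sqrt_nonneg (2 * p / (p + 1) - √(2 * p / (p + 1)))
  rw [t0]; linarith

theorem Lpoly_neg {p s₀ s : ℝ} (hp : 1 < p) (hs₀ : 2 < s₀) (hroot : Lpoly p s₀ = 0)
    (hs2 : 2 ≤ s) (hs : s < s₀) : Lpoly p s < 0 := by
  have hp1 : 0 < p + 1 := by linarith
  set a := 32 * p / (p + 1) with ha
  set b := 32 * p * (p + 3) / (p + 1) ^ 2 with hb
  set c := 64 * p / (p + 1) ^ 2 with hc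
  have hL : ∀ t, Lpoly p t = t ^ 4 - a * t ^ 2 + b * t - c := fun t => rfl
  have h1 : 0 < 1 - a + b - c := by
    have : 1 - a + b - c = 1 := by rw [ha, hb, hc]; field_simp; ring
    linarith
  have h2 : 16 - 4 * a + 2 * b - c < 0 := by
    have : 16 - 4 * a + 2 * b - c = -(16 * (3 * p + 1) * (p - 1) / (p + 1) ^ 2) := by
      rw [ha, hb, hc]; field_simp; ring
    rw [this, neg_lt_zero]
    have : 0 < p - 1 := by linarith
    positivity
  rw [hL] at hroot
  rw [hL]
  clear_value a b c
  let M : ℝ → ℝ := fun t => t ^ 3 + s₀ * t ^ 2 + (s₀ ^ 2 - a) * t + (s₀ ^ 3 - a * s₀ + b)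
  have hM : ∀ t, t ^ 4 - a * t ^ 2 + b * t - c = (t - s₀) * M t := fun t => by
    linear_combination hroot
  have m1 : M 1 < 0 := by
    by_contra! h
    have := hM 1
    nlinarith
  have m2 : 0 < M 2 := by
    by_contra! h
    have := hM 2
    nlinarith
  have ms : 0 < M s := by
    -- convexity of the cubic factor on `[1, s]`
    have key : M s - M 2 - (s - 2) * (M 2 - M 1) = (s - 2) * (s - 1) * (s + 3 + s₀) := by
      simp only [M]; ring
    have : 0 ≤ (s - 2) * (s - 1) * (s + 3 + s₀) :=
      mul_nonneg (mul_nonneg (by linarith) (by linarith)) (by linarith)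
    nlinarith
  rw [hM]
  exact mul_neg_of_neg_of_pos (by linarith) ms

end Polynomial

section Iteration

variable {N : ℕ}

/-- The `L^β` norm of a positive function `v` over the ball of radius `R` about the origin. -/
noncomputable def ballNorm (v : EuclideanSpace ℝ (Fin N) → ℝ) (β R : ℝ) : ℝ :=
  (∫ x in Metric.ball (0 : EuclideanSpace ℝ (Fin N)) R, v x ^ β) ^ (1 / β)

/-- A scale-invariant reverse Hölder inequality between `L^β` and `L^2` on concentric balls. -/
def ReverseHolderL2 (v : EuclideanSpace ℝ (Fin N) → ℝ) (β : ℝ) : Prop :=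
  ∃ m : ℕ, ∃ C : ℝ, 0 < C ∧ ∀ R : ℝ, 0 < R →
    ballNorm v β R ≤ C * R ^ ((N : ℝ) * (1 / β - 1 / 2)) * ballNorm v 2 (2 ^ m * R)

variable {v : EuclideanSpace ℝ (Fin N) → ℝ}

theorem integral_ball_rpow_nonneg (hv0 : ∀ x, 0 < v x) (β R : ℝ) :
    0 ≤ ∫ x in Metric.ball (0 : EuclideanSpace ℝ (Fin N)) R, v x ^ β :=
  integral_nonneg fun x => (rpow_pos_of_pos (hv0 x) _).le

theorem ballNorm_nonneg (hv0 : ∀ x, 0 < v x) (β R : ℝ) : 0 ≤ ballNorm v β R :=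
  rpow_nonneg (integral_ball_rpow_nonneg hv0 β R) _

theorem integrableOn_ball_of_continuous {f : EuclideanSpace ℝ (Fin N) → ℝ} (hf : Continuous f)
    (R : ℝ) : IntegrableOn f (Metric.ball 0 R) :=
  (hf.continuousOn.integrableOn_compact (isCompact_closedBall 0 R)).mono_set
    Metric.ball_subset_closedBall

theorem ballNorm_mono (hv : Continuous v) (hv0 : ∀ x, 0 < v x) {β r R : ℝ} (hβ : 0 < β)
    (hr : r ≤ R) : ballNorm v β r ≤ ballNorm v β R := by
  refine rpow_le_rpow (integral_ball_rpow_nonneg hv0 β r) ?_ (by positivity)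
  exact setIntegral_mono_set
    (integrableOn_ball_of_continuous (hv.rpow_const fun x => Or.inl (hv0 x).ne') R)
    (.of_forall fun x => (rpow_pos_of_pos (hv0 x) _).le)
    (Metric.ball_subset_ball hr).eventuallyLE

theorem ballNorm_le_of_lt (hv : Continuous v) (hv0 : ∀ x, 0 < v x) {β γ R : ℝ} (hβ : 0 < β)
    (hβγ : β < γ) (hR : 0 < R) :
    ballNorm v β R ≤ volume.real (Metric.ball (0 : EuclideanSpace ℝ (Fin N)) 1) ^ (1 / β - 1 / γ) *
      R ^ ((N : ℝ) * (1 / β - 1 / γ)) * ballNorm v γ R := by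
  have hγ : 0 < γ := hβ.trans hβγ
  set B := Metric.ball (0 : EuclideanSpace ℝ (Fin N)) R with hB
  have hpq : (γ / β).HolderConjugate (γ / (γ - β)) := by
    rw [Real.holderConjugate_iff]
    refine ⟨by rwa [lt_div_iff₀ hβ, one_mul], ?_⟩
    have : γ - β ≠ 0 := by linarith
    field_simp
    ring
  have hvβ : Continuous fun x => v x ^ β := hv.rpow_const fun x => Or.inl (hv0 x).ne'
  have : IsFiniteMeasure (volume.restrict B) := by
    constructor
    rw [Measure.restrict_apply_univ]
    exact measure_ball_lt_top
  have hmem : MemLp (fun x => v x ^ β) (ENNReal.ofReal (γ / β)) (volume.restrict B) := by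
    obtain ⟨M, hM⟩ :=
      (isCompact_closedBall (0 : EuclideanSpace ℝ (Fin N)) R).exists_bound_of_continuousOn
      hvβ.continuousOn
    refine MemLp.of_bound hvβ.aestronglyMeasurable M ?_
    refine (ae_restrict_iff' Metric.isOpen_ball.measurableSet).2 (.of_forall fun x hx => ?_)
    exact hM x (Metric.ball_subset_closedBall hx)
  have h := integral_mul_le_Lp_mul_Lq_of_nonneg hpq
    (.of_forall fun x => (rpow_pos_of_pos (hv0 x) β).le) (.of_forall fun _ => zero_le_one) hmem
    (memLp_const (1 : ℝ))
  have e1 : ∀ x, (v x ^ β) ^ (γ / β) = v x ^ γ := fun x => by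
    rw [← rpow_mul (hv0 x).le]; congr 1; field_simp
  have hvol : volume.real B =
      R ^ N * volume.real (Metric.ball (0 : EuclideanSpace ℝ (Fin N)) 1) := by
    rw [hB, measureReal_def, Measure.addHaar_ball_of_pos _ _ hR, finrank_euclideanSpace_fin,
      ENNReal.toReal_mul, ENNReal.toReal_ofReal (by positivity), measureReal_def]
  simp only [mul_one, one_rpow, e1, integral_const, smul_eq_mul,
    measureReal_restrict_apply_univ] at h
  have hI := integral_ball_rpow_nonneg hv0 γ R
  have hI' := integral_ball_rpow_nonneg hv0 β R
  have h' := rpow_le_rpow hI' h (one_div_nonneg.2 hβ.le)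
  have hW : 0 ≤ volume.real (Metric.ball (0 : EuclideanSpace ℝ (Fin N)) 1) := measureReal_nonneg
  rw [mul_rpow (by positivity) (by positivity), ← rpow_mul hI, ← rpow_mul (by positivity)] at h'
  have a1 : 1 / (γ / β) * (1 / β) = 1 / γ := by field_simp
  have a2 : 1 / (γ / (γ - β)) * (1 / β) = 1 / β - 1 / γ := by
    have : γ - β ≠ 0 := by linarith
    field_simp
  rw [a1, a2, hvol, mul_rpow (by positivity) hW, ← rpow_natCast, ← rpow_mul hR.le] at h'
  calc ballNorm v β R ≤ _ := h'
    _ = _ := by rw [ballNorm]; ring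

theorem ReverseHolderL2.two : ReverseHolderL2 v 2 :=
  ⟨0, 1, one_pos, fun R _ => by simp⟩

theorem ReverseHolderL2.mono (hv : Continuous v) (hv0 : ∀ x, 0 < v x) {β γ : ℝ}
    (h : ReverseHolderL2 v γ) (hβ : 0 < β) (hβγ : β < γ) : ReverseHolderL2 v β := by
  obtain ⟨m, C, hC, hm⟩ := h
  set W := volume.real (Metric.ball (0 : EuclideanSpace ℝ (Fin N)) 1) ^ (1 / β - 1 / γ) with hW
  have hW0 : 0 ≤ W := rpow_nonneg measureReal_nonneg _
  refine ⟨m, (W + 1) * C, by positivity, fun R hR => ?_⟩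
  have h0 := ballNorm_nonneg hv0 2 (2 ^ m * R)
  calc ballNorm v β R ≤ W * R ^ ((N : ℝ) * (1 / β - 1 / γ)) * ballNorm v γ R :=
        ballNorm_le_of_lt hv hv0 hβ hβγ hR
    _ ≤ (W + 1) * R ^ ((N : ℝ) * (1 / β - 1 / γ)) *
        (C * R ^ ((N : ℝ) * (1 / γ - 1 / 2)) * ballNorm v 2 (2 ^ m * R)) :=
        mul_le_mul (mul_le_mul_of_nonneg_right (by linarith) (by positivity)) (hm R hR)
          (ballNorm_nonneg hv0 _ _) (by positivity)
    _ = (W + 1) * C * (R ^ ((N : ℝ) * (1 / β - 1 / γ)) * R ^ ((N : ℝ) * (1 / γ - 1 / 2))) *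
        ballNorm v 2 (2 ^ m * R) := by ring
    _ = _ := by rw [← rpow_add hR]; congr 3; ring

theorem ReverseHolderL2.sobolev_step (hN : 2 < N) (hv0 : ∀ x, 0 < v x) {s C₀ : ℝ} (hs : 0 < s)
    (h : ReverseHolderL2 v s) (hC₀ : 0 < C₀)
    (hstep : ∀ R : ℝ, 0 < R →
      (∫ x in Metric.ball (0 : EuclideanSpace ℝ (Fin N)) R,
        v x ^ ((N : ℝ) / (N - 2) * s)) ^ (((N : ℝ) / (N - 2))⁻¹) ≤
      C₀ * R ^ (-2 : ℝ) * ∫ x in Metric.ball (0 : EuclideanSpace ℝ (Fin N)) (2 * R), v x ^ s) :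
    ReverseHolderL2 v ((N : ℝ) / (N - 2) * s) := by
  have hN' : (2 : ℝ) < N := by exact_mod_cast hN
  obtain ⟨m, C, hC, hm⟩ := h
  have hN2 : (N : ℝ) - 2 ≠ 0 := by linarith
  have hN0 : (N : ℝ) ≠ 0 := by linarith
  have hexp : -2 * (1 / s) = (N : ℝ) * (1 / ((N : ℝ) / (N - 2) * s) - 1 / s) := by
    field_simp; ring
  set κ : ℝ := (N : ℝ) / (N - 2) with hκ
  have hκ0 : 0 < κ := div_pos (by linarith) (by linarith)
  set D := (2 : ℝ) ^ ((N : ℝ) * (1 / s - 1 / 2)) with hD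
  have hD0 : 0 < D := by positivity
  refine ⟨m + 1, C₀ ^ (1 / s) * C * D, by positivity, fun R hR => ?_⟩
  have hI := integral_ball_rpow_nonneg hv0 (κ * s) R
  have hJ := integral_ball_rpow_nonneg hv0 s (2 * R)
  have h1 := rpow_le_rpow (rpow_nonneg hI _) (hstep R hR) (one_div_nonneg.2 hs.le)
  rw [← rpow_mul hI, mul_rpow (by positivity) hJ, mul_rpow hC₀.le (by positivity),
    ← rpow_mul hR.le, hexp] at h1
  have h2 := hm (2 * R) (by positivity)
  rw [mul_rpow zero_le_two hR.le, ← hD] at h2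
  have e1 : κ⁻¹ * (1 / s) = 1 / (κ * s) := by field_simp
  rw [e1] at h1
  have e3 : (2 : ℝ) ^ m * (2 * R) = 2 ^ (m + 1) * R := by rw [pow_succ]; ring
  rw [e3] at h2
  calc ballNorm v (κ * s) R ≤ C₀ ^ (1 / s) * R ^ ((N : ℝ) * (1 / (κ * s) - 1 / s)) *
        ballNorm v s (2 * R) := h1
    _ ≤ C₀ ^ (1 / s) * R ^ ((N : ℝ) * (1 / (κ * s) - 1 / s)) *
        (C * (D * R ^ ((N : ℝ) * (1 / s - 1 / 2))) * ballNorm v 2 (2 ^ (m + 1) * R)) :=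
        mul_le_mul_of_nonneg_left h2 (by positivity)
    _ = C₀ ^ (1 / s) * C * D * (R ^ ((N : ℝ) * (1 / (κ * s) - 1 / s)) *
        R ^ ((N : ℝ) * (1 / s - 1 / 2))) * ballNorm v 2 (2 ^ (m + 1) * R) := by ring
    _ = _ := by rw [← rpow_add hR]; congr 3; ring

theorem reverseHolderL2_of_step (hv : Continuous v) (hv0 : ∀ x, 0 < v x) {κ s₀ : ℝ} (hκ : 1 < κ)
    (hs₀ : 2 < s₀)
    (hstep : ∀ s, 2 ≤ s → s < s₀ → ReverseHolderL2 v s → ReverseHolderL2 v (κ * s))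
    {β : ℝ} (hβ : 2 ≤ β) (hβ' : β < κ * s₀) : ReverseHolderL2 v β := by
  have hκ0 : 0 < κ := by linarith
  have key : ∀ n : ℕ, ∀ β, 2 ≤ β → β < κ * s₀ → β < 2 * κ ^ n → ReverseHolderL2 v β := by
    intro n
    induction n with
    | zero => intro β h1 _ h3; simp at h3; linarith
    | succ n ih =>
      intro β h1 h2 h3
      rcases le_or_gt (2 * κ) β with h | h
      · have e : κ * (β / κ) = β := by field_simp
        rw [← e]
        have h4 : β / κ < s₀ := by rw [div_lt_iff₀ hκ0]; linarith
        have h5 : 2 ≤ β / κ := by rwa [le_div_iff₀ hκ0]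
        refine hstep _ h5 h4 (ih _ h5 (by nlinarith) ?_)
        rw [div_lt_iff₀ hκ0]
        calc β < _ := h3
          _ = _ := by ring
      · exact (hstep 2 le_rfl hs₀ .two).mono hv hv0 (by linarith) (by linarith)
  obtain ⟨n, hn⟩ := pow_unbounded_of_one_lt (β / 2) hκ
  exact key n β hβ hβ' (by linarith)

end Iteration

/-- Corollary 3.1: if `u` is a classical stable solution of `Δ²u = u^p`, `u > 0` in `ℝ^N`
and `v = -Δu`, then for every `2 ≤ β < (N/(N−2))s₀` there are `ℓ ∈ ℕ` and `C > 0` with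
`(∫_{B_R} v^β)^{1/β} ≤ C R^{(N/2)(2/β − 1)} (∫_{B_{2^{3ℓ}R}} v²)^{1/2}` for all `R > 0`. -/
theorem iterated_integral_estimate
    (N : ℕ) (hN : 5 ≤ N) (p : ℝ) (hp : 1 < p) (s₀ : ℝ)
    (hs₀gt : 2 * t0 p < s₀) (hs₀root : Lpoly p s₀ = 0)
    (hs₀uniq : ∀ s : ℝ, 2 * t0 p < s → Lpoly p s = 0 → s = s₀)
    (u : EuclideanSpace ℝ (Fin N) → ℝ) (hu : ContDiff ℝ 4 u)
    (hpos : ∀ x, 0 < u x) (heq : ∀ x, lap (lap u) x = u x ^ p)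
    (hstable : ∀ φ : EuclideanSpace ℝ (Fin N) → ℝ, ContDiff ℝ (⊤ : ℕ∞) φ →
      HasCompactSupport φ →
      p * ∫ x, u x ^ (p - 1) * φ x ^ 2 ≤ ∫ x, (lap φ x) ^ 2) :
    ∀ β : ℝ, 2 ≤ β → β < (N : ℝ) / ((N : ℝ) - 2) * s₀ →
      ∃ ℓ : ℕ, ∃ C : ℝ, 0 < C ∧ ∀ R : ℝ, 0 < R →
        (∫ x in Metric.ball (0 : EuclideanSpace ℝ (Fin N)) R,
            (-(lap u x)) ^ β) ^ (1 / β)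
          ≤ C * R ^ ((N : ℝ) / 2 * (2 / β - 1)) *
            (∫ x in Metric.ball (0 : EuclideanSpace ℝ (Fin N)) (2 ^ (3 * ℓ) * R),
              (-(lap u x)) ^ 2) ^ (1 / 2 : ℝ) := by
  intro β hβ hβ'
  have hN2 : (2 : ℝ) < N := by exact_mod_cast (by omega : 2 < N)
  have hp0 : 0 < p := by linarith
  have hs₀2 : 2 < s₀ := by linarith [one_lt_t0 hp]
  have hlapC : ContDiff ℝ 2 (lap u) := contDiff_lap hu (by norm_num)
  set v : EuclideanSpace ℝ (Fin N) → ℝ := fun x => -lap u x with hv_def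
  have hv : ContDiff ℝ 2 v := hlapC.neg
  have hv0 : ∀ x, 0 < v x := fun x =>
    neg_pos.2 (lap_neg_of_solution (by omega) hp hu hpos heq x)
  have hvu : ∀ x, -lap v x = u x ^ p := fun x => by
    rw [hv_def, lap_neg, neg_neg, heq]
  have hV0 : ∀ x, 0 < √p * u x ^ ((p - 1) / 2) := fun x =>
    mul_pos (sqrt_pos.2 hp0) (rpow_pos_of_pos (hpos x) _)
  have hVc : Continuous fun x => √p * u x ^ ((p - 1) / 2) :=
    continuous_const.mul (hu.continuous.rpow_const fun x => Or.inl (hpos x).ne')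
  have hV : ∀ φ : EuclideanSpace ℝ (Fin N) → ℝ, ContDiff ℝ (⊤ : ℕ∞) φ → HasCompactSupport φ →
      ∫ x, (√p * u x ^ ((p - 1) / 2)) ^ 2 * φ x ^ 2 ≤ ∫ x, lap φ x ^ 2 := fun φ hφ hφc => by
    refine le_of_eq_of_le ?_ (hstable φ hφ hφc)
    rw [← integral_const_mul]
    congr 1 with x
    rw [mul_pow, sq_sqrt hp0.le, ← rpow_natCast (u x ^ _), ← rpow_mul (hpos x).le]
    push_cast
    rw [div_mul_cancel₀ _ two_ne_zero, mul_assoc]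
  have hst := fun φ (hφ : ContDiff ℝ 1 φ) hφc => integral_mul_sq_le_of_contDiff_one hVc
    (fun φ hφ hφc => integral_mul_sq_le_integral_gdot hVc hV0 hV hφ hφc) hφ hφc
  have hrev : ReverseHolderL2 v β := by
    refine reverseHolderL2_of_step hv.continuous hv0 (κ := (N : ℝ) / (N - 2))
      ((one_lt_div (by linarith)).2 (by linarith)) hs₀2 (fun s hs hss h => ?_) hβ hβ'
    obtain ⟨C₁, hC₁, hE⟩ := exists_integral_gdot_rpow_mul_le hp hs
      (Lpoly_neg hp hs₀2 hs₀root hs hss) (hu.of_le (by norm_num)) hv hpos hv0 (fun _ => rfl) hvu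
      (rpow_le_neg_lap_of_solution (by omega) hp hu hpos heq) hst
    obtain ⟨C₀, hC₀, hstep⟩ := exists_ball_rpow_le (by omega) hv hv0 hC₁ hE
    exact h.sobolev_step (by omega) hv0 (by linarith) hC₀ hstep
  obtain ⟨m, C, hC, hm⟩ := hrev
  refine ⟨m, C, hC, fun R hR => ?_⟩
  have hle : (2 : ℝ) ^ m * R ≤ 2 ^ (3 * m) * R :=
    mul_le_mul_of_nonneg_right (pow_le_pow_right₀ one_le_two (by omega)) hR.le
  have h := (hm R hR).trans (mul_le_mul_of_nonneg_left
    (ballNorm_mono hv.continuous hv0 two_pos hle) (by positivity))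
  have e : (N : ℝ) * (1 / β - 1 / 2) = N / 2 * (2 / β - 1) := by ring
  rw [e] at h
  simpa only [ballNorm, rpow_two] using h
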